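/- arXiv:2011.00465 — 2 statements merged into one kernel-verified Lean document; each statement's English description precedes it below -/
import Mathlib

section
/- If Φ ∈ C_c^∞(ℝ^n × ℝ^n) satisfies condition (A) (with d = 2n), then there exists a constant c ∈ (0,∞), depending only on n and Φ, such that for every L^∞ matrix A = (a_{μν})_{μ,ν∈ℤ^n} and every 1 ≤ q ≤ ∞ one has c^{-1} ‖A‖_B ≤ ‖σ_{A,Φ}‖_{M(L²×L² → (L²,ℓ^q))} ≤ c ‖A‖_B. -/
open MeasureTheory Complex
open scoped ENNReal NNReal

noncomputable section

abbrev Rn (n : ℕ) : Type := Fin n → ℝ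
abbrev Zn (n : ℕ) : Type := Fin n → ℤ

/-- Coercion of a lattice point to a point of `ℝ^n`. -/
def coeZ {n : ℕ} (μ : Zn n) : Rn n := fun i => (μ i : ℝ)

/-- The cube `aQ = [-a/2, a/2]^n`. -/
def cube (n : ℕ) (a : ℝ) : Set (Rn n) := Set.univ.pi fun _ => Set.Icc (-a / 2) (a / 2)

/-- A smooth compactly supported function. -/
def IsCcInfty {E : Type*} [NormedAddCommGroup E] [NormedSpace ℝ E] (Φ : E → ℂ) : Prop :=
  ContDiff ℝ (⊤ : ℕ∞) Φ ∧ HasCompactSupport Φ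

/-- The Fourier transform of a Schwartz function. -/
def ft {n : ℕ} (f : SchwartzMap (Rn n) ℂ) (ξ : Rn n) : ℂ :=
  ∫ x : Rn n, Complex.exp ((-2 * Real.pi * Complex.I) * ((∑ i, x i * ξ i : ℝ) : ℂ)) * f x

/-- The bilinear Fourier multiplier operator `T_σ(f,g)`. -/
def Tbil {n : ℕ} (σ : Rn n × Rn n → ℂ) (f g : SchwartzMap (Rn n) ℂ) (x : Rn n) : ℂ :=
  ∫ p : Rn n × Rn n,
    Complex.exp ((2 * Real.pi * Complex.I) * ((∑ i, x i * (p.1 i + p.2 i) : ℝ) : ℂ)) *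
      σ p * ft f p.1 * ft g p.2

/-- `L²` norm of `h(·+ν)` on the unit cube `Q`. -/
def localL2 {n : ℕ} (h : Rn n → ℂ) (ν : Zn n) : ℝ≥0∞ :=
  (∫⁻ x in cube n 1, (‖h (x + coeZ ν)‖₊ : ℝ≥0∞) ^ 2) ^ (1 / 2 : ℝ)

/-- The amalgam `(L², ℓ^q)` norm. -/
def amalgamNorm {n : ℕ} (q : ℝ≥0∞) (h : Rn n → ℂ) : ℝ≥0∞ :=
  if q = ∞ then ⨆ ν : Zn n, localL2 h ν
  else (∑' ν : Zn n, localL2 h ν ^ q.toReal) ^ (1 / q.toReal)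

/-- The multiplier norm `‖σ‖_{M(L²×L² → (L²,ℓ^q))}`. -/
def multNorm {n : ℕ} (q : ℝ≥0∞) (σ : Rn n × Rn n → ℂ) : ℝ≥0∞ :=
  ⨆ (f : SchwartzMap (Rn n) ℂ) (g : SchwartzMap (Rn n) ℂ)
    (_ : eLpNorm (⇑f) 2 volume = 1) (_ : eLpNorm (⇑g) 2 volume = 1),
    amalgamNorm q (Tbil σ f g)

/-- An `L^∞` matrix on `ℤ^n × ℤ^n`. -/
def IsLinftyMatrix {n : ℕ} (A : Zn n → Zn n → ℂ) : Prop :=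
  ∃ C : ℝ, ∀ μ ν, ‖A μ ν‖ ≤ C

/-- The norm `‖A‖_B`: the trilinear form norm over finitely supported unit `ℓ²` vectors. -/
def normB {n : ℕ} (A : Zn n → Zn n → ℂ) : ℝ≥0∞ :=
  ⨆ (F : Zn n →₀ ℂ) (G : Zn n →₀ ℂ) (H : Zn n →₀ ℂ)
    (_ : ∑ μ ∈ F.support, ‖F μ‖ ^ 2 = 1)
    (_ : ∑ ν ∈ G.support, ‖G ν‖ ^ 2 = 1)
    (_ : ∑ ρ ∈ H.support, ‖H ρ‖ ^ 2 = 1),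
    (‖∑ μ ∈ F.support, ∑ ν ∈ G.support, A μ ν * F μ * G ν * H (μ + ν)‖₊ : ℝ≥0∞)

/-- The multiplier `σ_{A,Φ}(ξ,η) = Σ_{μ,ν} a_{μν} Φ(ξ-μ, η-ν)`. -/
def sigmaA {n : ℕ} (A : Zn n → Zn n → ℂ) (Φ : Rn n × Rn n → ℂ) (p : Rn n × Rn n) : ℂ :=
  ∑' μν : Zn n × Zn n, A μν.1 μν.2 * Φ (p.1 - coeZ μν.1, p.2 - coeZ μν.2)

/-- Condition (A) for functions on `ℝ^d`. -/
def ConditionA {d : ℕ} (Φ : Rn d → ℂ) : Prop :=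
  ∃ Θ : Rn d → ℂ, ContDiff ℝ (⊤ : ℕ∞) Θ ∧ HasCompactSupport Θ ∧
    ∀ α : Zn d, (∫ x : Rn d, Θ x * Φ (x - coeZ α)) = if α = 0 then 1 else 0

/-- Condition (A) for functions on `ℝ^n × ℝ^n` (i.e. `d = 2n`). -/
def ConditionA2 {n : ℕ} (Φ : Rn n × Rn n → ℂ) : Prop :=
  ∃ Θ : Rn n × Rn n → ℂ, ContDiff ℝ (⊤ : ℕ∞) Θ ∧ HasCompactSupport Θ ∧
    ∀ α β : Zn n, (∫ p : Rn n × Rn n, Θ p * Φ (p.1 - coeZ α, p.2 - coeZ β)) =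
      if α = 0 ∧ β = 0 then 1 else 0

/-- Condition (A) for functions on `ℝ` (the case `d = 1`). -/
def ConditionA1 (Φ : ℝ → ℂ) : Prop :=
  ∃ θ : ℝ → ℂ, ContDiff ℝ (⊤ : ℕ∞) θ ∧ HasCompactSupport θ ∧
    ∀ j : ℤ, (∫ x : ℝ, θ x * Φ (x - (j : ℝ))) = if j = 0 then 1 else 0

/-- The `L^∞` (sup) norm, valued in `ℝ≥0∞`. -/
def supNorm {E : Type*} (u : E → ℂ) : ℝ≥0∞ := ⨆ x, (‖u x‖₊ : ℝ≥0∞)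

end

open scoped SchwartzMap FourierTransform

/-- The character `t ↦ e^{2πit}`. -/
noncomputable def chi (t : ℝ) : ℂ := Complex.exp ((2 * Real.pi * Complex.I) * (t : ℂ))

lemma chi_add (s t : ℝ) : chi (s + t) = chi s * chi t := by
  simp only [chi, ← Complex.exp_add]; congr 1; push_cast; ring

lemma chi_zero : chi 0 = 1 := by simp [chi]

lemma norm_chi (t : ℝ) : ‖chi t‖ = 1 := by
  have : (2 * Real.pi * Complex.I) * (t : ℂ) = ((2 * Real.pi * t : ℝ) : ℂ) * Complex.I := by
    push_cast; ring
  rw [chi, this, Complex.norm_exp_ofReal_mul_I]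

@[fun_prop]
lemma continuous_chi : Continuous chi := by unfold chi; fun_prop

@[fun_prop]
lemma measurable_chi : Measurable chi := continuous_chi.measurable

lemma chi_int (m : ℤ) : chi m = 1 := by
  rw [chi, Complex.exp_eq_one_iff]
  exact ⟨m, by push_cast; ring⟩

lemma conj_chi (t : ℝ) : (starRingEnd ℂ) (chi t) = chi (-t) := by
  rw [chi, ← Complex.exp_conj, chi]
  congr 1
  simp [map_ofNat]

lemma chi_sub (s t : ℝ) : chi (s - t) = chi s * chi (-t) := by
  rw [sub_eq_add_neg, chi_add]

@[fun_prop]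
lemma continuous_dot {n : ℕ} {X : Type*} [TopologicalSpace X] {f g : X → Rn n}
    (hf : Continuous f) (hg : Continuous g) : Continuous fun x => f x ⬝ᵥ g x :=
  hf.dotProduct hg

lemma coeZ_dot {n : ℕ} (μ ν : Zn n) : coeZ μ ⬝ᵥ coeZ ν = ((μ ⬝ᵥ ν : ℤ) : ℝ) := by
  simp [dotProduct, coeZ]

lemma coeZ_add {n : ℕ} (μ ν : Zn n) : coeZ (μ + ν) = coeZ μ + coeZ ν := by
  ext i; simp [coeZ]

lemma coeZ_zero {n : ℕ} : coeZ (0 : Zn n) = 0 := by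
  ext i; simp [coeZ]

lemma coeZ_neg {n : ℕ} (μ : Zn n) : coeZ (-μ) = -coeZ μ := by
  ext i; simp [coeZ]

lemma coeZ_sub {n : ℕ} (μ ν : Zn n) : coeZ (μ - ν) = coeZ μ - coeZ ν := by
  ext i; simp [coeZ]

section FourierTransfer

variable {n : ℕ}

/-- A Schwartz function on `Fin n → ℝ` viewed on Euclidean space. -/
noncomputable def toEuclid (f : SchwartzMap (Rn n) ℂ) : 𝓢(EuclideanSpace ℝ (Fin n), ℂ) :=
  SchwartzMap.compCLMOfContinuousLinearEquiv ℂ (EuclideanSpace.equiv (Fin n) ℝ) f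

lemma ft_eq_fourier (f : SchwartzMap (Rn n) ℂ) (ξ : Rn n) :
    ft f ξ = 𝓕 (toEuclid f) (WithLp.toLp 2 ξ) := by
  rw [SchwartzMap.fourier_coe, Real.fourier_eq', ft,
    ← (PiLp.volume_preserving_toLp (Fin n)).integral_comp
      (MeasurableEquiv.toLp 2 (Fin n → ℝ)).measurableEmbedding]
  congr 1
  ext x
  simp only [smul_eq_mul]
  congr 1
  · congr 1
    simp only [EuclideanSpace.inner_toLp_toLp, dotProduct, star_trivial]
    push_cast
    simp_rw [mul_comm (x _ : ℂ) (ξ _ : ℂ)]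
    ring

lemma ft_continuous (f : SchwartzMap (Rn n) ℂ) : Continuous (ft f) := by
  have : ft f = fun ξ => 𝓕 (toEuclid f) (WithLp.toLp 2 ξ) := funext (ft_eq_fourier f)
  rw [this]
  exact (𝓕 (toEuclid f)).continuous.comp (PiLp.continuous_toLp 2 _)

lemma ft_integrable (f : SchwartzMap (Rn n) ℂ) : Integrable (ft f) := by
  have : ft f = fun ξ => 𝓕 (toEuclid f) (WithLp.toLp 2 ξ) := funext (ft_eq_fourier f)
  rw [this]
  exact ((PiLp.volume_preserving_toLp (Fin n)).integrable_comp_emb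
      (MeasurableEquiv.toLp 2 (Fin n → ℝ)).measurableEmbedding).2 (𝓕 (toEuclid f)).integrable

lemma lintegral_sq_eq_ofReal {E : Type*} [NormedAddCommGroup E] [NormedSpace ℝ E]
    [MeasurableSpace E] [BorelSpace E] [SecondCountableTopology E]
    (μ : Measure E) [μ.HasTemperateGrowth] (f : 𝓢(E, ℂ)) :
    ∫⁻ x, ‖f x‖ₑ ^ 2 ∂μ = ENNReal.ofReal (∫ x, ‖f x‖ ^ 2 ∂μ) := by
  rw [ofReal_integral_eq_lintegral_ofReal]
  · congr 1; ext x
    rw [ENNReal.ofReal_pow (norm_nonneg _), ofReal_norm]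
  · exact (f.memLp 2 μ).integrable_norm_pow (by norm_num)
  · exact Filter.Eventually.of_forall fun x => by positivity

lemma lintegral_ft_sq (f : SchwartzMap (Rn n) ℂ) :
    ∫⁻ ξ, ‖ft f ξ‖ₑ ^ 2 = ∫⁻ x, ‖f x‖ₑ ^ 2 := by
  have hT := PiLp.volume_preserving_toLp (Fin n)
  have hme := (MeasurableEquiv.toLp 2 (Fin n → ℝ)).measurableEmbedding
  calc ∫⁻ ξ, ‖ft f ξ‖ₑ ^ 2 = ∫⁻ ξ, ‖𝓕 (toEuclid f) (WithLp.toLp 2 ξ)‖ₑ ^ 2 := by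
        simp_rw [ft_eq_fourier]
    _ = ∫⁻ w, ‖𝓕 (toEuclid f) w‖ₑ ^ 2 :=
        hT.lintegral_comp_emb hme (fun w => ‖𝓕 (toEuclid f) w‖ₑ ^ 2)
    _ = ∫⁻ w, ‖toEuclid f w‖ₑ ^ 2 := by
        rw [lintegral_sq_eq_ofReal, lintegral_sq_eq_ofReal, SchwartzMap.integral_norm_sq_fourier]
    _ = ∫⁻ x, ‖toEuclid f (WithLp.toLp 2 x)‖ₑ ^ 2 :=
        (hT.lintegral_comp_emb hme (fun w => ‖toEuclid f w‖ₑ ^ 2)).symm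
    _ = ∫⁻ x, ‖f x‖ₑ ^ 2 := rfl

lemma exists_ft_eq {u : Rn n → ℂ} (hu : IsCcInfty u) :
    ∃ f : SchwartzMap (Rn n) ℂ, ft f = u := by
  let s : SchwartzMap (Rn n) ℂ := hu.2.toSchwartzMap hu.1
  refine ⟨SchwartzMap.compCLMOfContinuousLinearEquiv ℂ (EuclideanSpace.equiv (Fin n) ℝ).symm
    (𝓕⁻ (toEuclid s)), ?_⟩
  ext ξ
  rw [ft_eq_fourier]
  have : toEuclid (SchwartzMap.compCLMOfContinuousLinearEquiv ℂ
      (EuclideanSpace.equiv (Fin n) ℝ).symm (𝓕⁻ (toEuclid s))) = 𝓕⁻ (toEuclid s) := by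
    ext w; simp [toEuclid]
  rw [this, FourierTransform.fourier_fourierInv_eq]
  rfl

end FourierTransfer

section Representation

variable {n : ℕ}

/-- The Euclidean structure on `ℝ^n × ℝ^n`. -/
abbrev E2 (n : ℕ) : Type := WithLp 2 (EuclideanSpace ℝ (Fin n) × EuclideanSpace ℝ (Fin n))

/-- The identification of `ℝ^n × ℝ^n` with its Euclidean version. -/
noncomputable def toE2 (n : ℕ) : (Rn n × Rn n) ≃L[ℝ] E2 n :=
  (((EuclideanSpace.equiv (Fin n) ℝ).prodCongr (EuclideanSpace.equiv (Fin n) ℝ)).symm).trans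
    (WithLp.prodContinuousLinearEquiv 2 ℝ _ _).symm

lemma toE2_measurePreserving : MeasurePreserving (toE2 n) := by
  have h1 : MeasurePreserving (Prod.map (@WithLp.toLp 2 (Fin n → ℝ)) (@WithLp.toLp 2 (Fin n → ℝ)))
      (volume : Measure (Rn n × Rn n)) volume :=
    (PiLp.volume_preserving_toLp (Fin n)).prod (PiLp.volume_preserving_toLp (Fin n))
  have h2 := WithLp.volume_preserving_toLp (EuclideanSpace ℝ (Fin n)) (EuclideanSpace ℝ (Fin n))
  exact h2.comp h1

lemma inner_toE2 (p q : Rn n × Rn n) :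
    inner ℝ (toE2 n p) (toE2 n q) = p.1 ⬝ᵥ q.1 + p.2 ⬝ᵥ q.2 := by
  simp [toE2, WithLp.prod_inner_apply, dotProduct, PiLp.inner_apply, mul_comm]

/-- A smooth compactly supported function is a superposition of characters, with an integrable
Schwartz density. -/
lemma exists_fourier_density {Θ : Rn n × Rn n → ℂ} (hΘ : IsCcInfty Θ) :
    ∃ K : 𝓢(Rn n × Rn n, ℂ), ∀ p : Rn n × Rn n,
      Θ p = ∫ κ : Rn n × Rn n, K κ * chi (κ.1 ⬝ᵥ p.1 + κ.2 ⬝ᵥ p.2) := by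
  let s : 𝓢(Rn n × Rn n, ℂ) := hΘ.2.toSchwartzMap hΘ.1
  let s' : 𝓢(E2 n, ℂ) := SchwartzMap.compCLMOfContinuousLinearEquiv ℂ (toE2 n).symm s
  refine ⟨SchwartzMap.compCLMOfContinuousLinearEquiv ℂ (toE2 n) (𝓕 s'), fun p => ?_⟩
  have h : (𝓕⁻ (𝓕 s')) (toE2 n p) = Θ p := by
    rw [FourierTransform.fourierInv_fourier_eq]
    simp [s', s]
  rw [← h, SchwartzMap.fourierInv_coe, Real.fourierInv_eq',
    ← toE2_measurePreserving.integral_comp (toE2 n).toHomeomorph.measurableEmbedding]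
  congr 1
  ext κ
  simp only [smul_eq_mul, SchwartzMap.compCLMOfContinuousLinearEquiv_apply, Function.comp_apply]
  rw [mul_comm, inner_toE2, chi]
  congr 2
  push_cast
  ring

end Representation

section Cube

variable {n : ℕ}

lemma measurableSet_cube (a : ℝ) : MeasurableSet (cube n a) :=
  MeasurableSet.univ_pi fun _ => measurableSet_Icc

lemma cube_norm_le {y : Rn n} (hy : y ∈ cube n 1) : ‖y‖ ≤ 1 / 2 := by
  rw [pi_norm_le_iff_of_nonneg (by norm_num)]
  intro i
  have := hy i (Set.mem_univ i)
  rw [Real.norm_eq_abs, abs_le]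
  constructor <;> [have := this.1; have := this.2] <;> linarith

lemma neg_mem_cube {y : Rn n} (hy : y ∈ cube n 1) : -y ∈ cube n 1 := by
  intro i _
  have := hy i (Set.mem_univ i)
  simp only [Pi.neg_apply, Set.mem_Icc] at *
  constructor <;> linarith

lemma volume_cube_one : volume (cube n 1) = 1 := by
  rw [cube, volume_pi_pi]
  simp [Real.volume_Icc]
  norm_num

/-- The translates of the unit cube by lattice points cover the space. -/
lemma lintegral_le_tsum_cube (g : Rn n → ℝ≥0∞) :
    ∫⁻ x, g x ≤ ∑' τ : Zn n, ∫⁻ y in cube n 1, g (y + coeZ τ) := by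
  have hcov : (⋃ τ : Zn n, (fun y => y + coeZ τ) '' cube n 1) = Set.univ := by
    rw [Set.eq_univ_iff_forall]
    intro x
    refine Set.mem_iUnion.2 ⟨fun i => round (x i), fun i => x i - round (x i), ?_, ?_⟩
    · intro i _
      have := abs_le.1 (abs_sub_round (x i))
      constructor <;> [have := this.1; have := this.2] <;> linarith
    · ext i; simp [coeZ]
  calc ∫⁻ x, g x = ∫⁻ x in ⋃ τ : Zn n, (fun y => y + coeZ τ) '' cube n 1, g x := by
        rw [hcov, Measure.restrict_univ]
    _ ≤ ∑' τ : Zn n, ∫⁻ x in (fun y => y + coeZ τ) '' cube n 1, g x := lintegral_iUnion_le _ _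
    _ = _ := by
        congr 1; ext τ
        exact (measurePreserving_add_right volume (coeZ τ)).setLIntegral_comp_emb
          (MeasurableEquiv.addRight (coeZ τ)).measurableEmbedding g (cube n 1) |>.symm

lemma integral_chi_Icc (m : ℤ) :
    ∫ t in Set.Icc (-1 / 2 : ℝ) (1 / 2), chi (m * t) = if m = 0 then 1 else 0 := by
  split_ifs with h
  · subst h
    simp [chi_zero]
    norm_num
  · rw [integral_Icc_eq_integral_Ioc, ← intervalIntegral.integral_of_le (by norm_num)]
    have hc : (2 * Real.pi * Complex.I) * (m : ℂ) ≠ 0 := by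
      simp [Real.pi_ne_zero, h]
    have : ∀ t : ℝ, chi (m * t) = Complex.exp ((2 * Real.pi * Complex.I) * (m : ℂ) * t) := by
      intro t; rw [chi]; congr 1; push_cast; ring
    simp_rw [this]
    rw [integral_exp_mul_complex hc]
    have h1 : Complex.exp ((2 * Real.pi * Complex.I) * (m : ℂ) * ((1 / 2 : ℝ) : ℂ)) =
        Complex.exp ((2 * Real.pi * Complex.I) * (m : ℂ) * ((-1 / 2 : ℝ) : ℂ)) := by
      rw [Complex.exp_eq_exp_iff_exists_int]
      exact ⟨m, by push_cast; ring⟩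
    rw [h1, sub_self, zero_div]

lemma integral_chi_cube (τ : Zn n) :
    ∫ y in cube n 1, chi (coeZ τ ⬝ᵥ y) = if τ = 0 then 1 else 0 := by
  have h1 : ∀ y : Rn n, chi (coeZ τ ⬝ᵥ y) = ∏ i, chi (τ i * y i) := by
    intro y
    simp only [chi, dotProduct, coeZ, ← Complex.exp_sum, ← Finset.mul_sum]
    congr 2
    push_cast
    rfl
  simp_rw [h1]
  rw [cube, volume_pi, Measure.restrict_pi_pi]
  rw [integral_fintype_prod_eq_prod (f := fun i t => chi (τ i * t))]
  simp_rw [integral_chi_Icc]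
  split_ifs with h
  · subst h; simp
  · obtain ⟨i, hi⟩ := Function.ne_iff.1 h
    exact Finset.prod_eq_zero (Finset.mem_univ i) (if_neg hi)

lemma enorm_sq_eq_ofReal (z : ℂ) : ‖z‖ₑ ^ 2 = ENNReal.ofReal (‖z‖ ^ 2) := by
  rw [ENNReal.ofReal_pow (norm_nonneg _), ofReal_norm]

lemma integrableOn_cube_of_continuous {E : Type*} [NormedAddCommGroup E] {g : Rn n → E}
    (hg : Continuous g) :
    IntegrableOn g (cube n 1) :=
  hg.continuousOn.integrableOn_compact (isCompact_univ_pi fun _ => isCompact_Icc)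

/-- Parseval's identity for trigonometric polynomials on the unit cube. -/
lemma parseval_cube (R : Finset (Zn n)) (c : Zn n → ℂ) :
    ∫⁻ y in cube n 1, ‖∑ τ ∈ R, c τ * chi (coeZ τ ⬝ᵥ y)‖ₑ ^ 2 = ∑ τ ∈ R, ‖c τ‖ₑ ^ 2 := by
  have key : ∫ y in cube n 1, ‖∑ τ ∈ R, c τ * chi (coeZ τ ⬝ᵥ y)‖ ^ 2 = ∑ τ ∈ R, ‖c τ‖ ^ 2 := by
    apply Complex.ofReal_injective
    rw [← integral_complex_ofReal]
    have h1 : ∀ y : Rn n, ((‖∑ τ ∈ R, c τ * chi (coeZ τ ⬝ᵥ y)‖ ^ 2 : ℝ) : ℂ) =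
        ∑ τ ∈ R, ∑ ρ ∈ R, c τ * (starRingEnd ℂ) (c ρ) * chi (coeZ (τ - ρ) ⬝ᵥ y) := by
      intro y
      push_cast
      rw [← Complex.mul_conj', map_sum, Finset.sum_mul_sum]
      refine Finset.sum_congr rfl fun τ _ => Finset.sum_congr rfl fun ρ _ => ?_
      rw [map_mul, conj_chi, coeZ_sub, sub_dotProduct, chi_sub]
      ring
    have hcont : ∀ τ ρ : Zn n, IntegrableOn
        (fun y => c τ * (starRingEnd ℂ) (c ρ) * chi (coeZ (τ - ρ) ⬝ᵥ y)) (cube n 1) :=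
      fun τ ρ => integrableOn_cube_of_continuous (by fun_prop)
    simp_rw [h1]
    rw [integral_finsetSum _ fun τ _ => integrable_finsetSum _ fun ρ _ => hcont τ ρ]
    push_cast
    refine Finset.sum_congr rfl fun τ hτ => ?_
    rw [integral_finsetSum _ fun ρ _ => hcont τ ρ]
    simp_rw [integral_const_mul, integral_chi_cube, sub_eq_zero]
    simp [hτ, Complex.mul_conj']
  simp_rw [enorm_sq_eq_ofReal]
  rw [← ofReal_integral_eq_lintegral_ofReal, key, ENNReal.ofReal_sum_of_nonneg]
  · intros; positivity
  · exact integrableOn_cube_of_continuous (by fun_prop)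
  · exact Filter.Eventually.of_forall fun x => by positivity

end Cube

section Trilinear

variable {n : ℕ}

lemma normB_finsupp_bound (A : Zn n → Zn n → ℂ) (F G H : Zn n →₀ ℂ) :
    ‖∑ μ ∈ F.support, ∑ ν ∈ G.support, A μ ν * F μ * G ν * H (μ + ν)‖ₑ ≤
      normB A * ENNReal.ofReal (√(∑ μ ∈ F.support, ‖F μ‖ ^ 2)) *
        ENNReal.ofReal (√(∑ μ ∈ G.support, ‖G μ‖ ^ 2)) *
        ENNReal.ofReal (√(∑ μ ∈ H.support, ‖H μ‖ ^ 2)) := by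
  by_cases hF : F = 0
  · simp [hF]
  by_cases hG : G = 0
  · simp [hG]
  by_cases hH : H = 0
  · simp [hH]
  have hpos : ∀ F : Zn n →₀ ℂ, F ≠ 0 → 0 < √(∑ μ ∈ F.support, ‖F μ‖ ^ 2) := by
    intro F hF
    refine Real.sqrt_pos.2 (Finset.sum_pos (fun i hi => ?_) (Finsupp.support_nonempty_iff.2 hF))
    have := norm_pos_iff.2 (Finsupp.mem_support_iff.1 hi)
    positivity
  have hunit : ∀ F : Zn n →₀ ℂ, F ≠ 0 → ∀ a : ℝ, a = √(∑ μ ∈ F.support, ‖F μ‖ ^ 2) →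
      (((a : ℂ)⁻¹ • F).support = F.support ∧
      ∑ μ ∈ ((a : ℂ)⁻¹ • F).support, ‖((a : ℂ)⁻¹ • F) μ‖ ^ 2 = 1) := by
    intro F hF a ha
    have h0 : 0 < a := ha ▸ hpos F hF
    have hs : ((a : ℂ)⁻¹ • F).support = F.support :=
      Finsupp.support_smul_eq (by simp [h0.ne'])
    refine ⟨hs, ?_⟩
    rw [hs]
    simp only [Finsupp.smul_apply, smul_eq_mul, norm_mul, mul_pow, ← Finset.mul_sum]
    have : ∑ μ ∈ F.support, ‖F μ‖ ^ 2 = a ^ 2 := by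
      rw [ha, Real.sq_sqrt (Finset.sum_nonneg fun _ _ => by positivity)]
    rw [this, norm_inv, Complex.norm_real, Real.norm_of_nonneg h0.le]
    field_simp
  have hFp := hpos F hF
  have hGp := hpos G hG
  have hHp := hpos H hH
  generalize ha : √(∑ μ ∈ F.support, ‖F μ‖ ^ 2) = a at *
  generalize hb : √(∑ μ ∈ G.support, ‖G μ‖ ^ 2) = b at *
  generalize hc : √(∑ μ ∈ H.support, ‖H μ‖ ^ 2) = c at *
  obtain ⟨hFs, hF1⟩ := hunit F hF a ha.symm
  obtain ⟨hGs, hG1⟩ := hunit G hG b hb.symm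
  obtain ⟨hHs, hH1⟩ := hunit H hH c hc.symm
  have hle : ‖∑ μ ∈ ((a : ℂ)⁻¹ • F).support, ∑ ν ∈ ((b : ℂ)⁻¹ • G).support,
      A μ ν * ((a : ℂ)⁻¹ • F) μ * ((b : ℂ)⁻¹ • G) ν * ((c : ℂ)⁻¹ • H) (μ + ν)‖ₑ ≤ normB A := by
    unfold normB
    exact le_iSup_of_le _ (le_iSup_of_le _ (le_iSup_of_le _
      (le_iSup_of_le hF1 (le_iSup_of_le hG1 (le_iSup_of_le hH1 le_rfl)))))
  have heq : ∑ μ ∈ F.support, ∑ ν ∈ G.support, A μ ν * F μ * G ν * H (μ + ν) =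
      ((a : ℂ) * b * c) * ∑ μ ∈ ((a : ℂ)⁻¹ • F).support, ∑ ν ∈ ((b : ℂ)⁻¹ • G).support,
      A μ ν * ((a : ℂ)⁻¹ • F) μ * ((b : ℂ)⁻¹ • G) ν * ((c : ℂ)⁻¹ • H) (μ + ν) := by
    rw [hFs, hGs, Finset.mul_sum]
    refine Finset.sum_congr rfl fun μ _ => ?_
    rw [Finset.mul_sum]
    refine Finset.sum_congr rfl fun ν _ => ?_
    have : (a : ℂ) ≠ 0 := by exact_mod_cast hFp.ne'
    have : (b : ℂ) ≠ 0 := by exact_mod_cast hGp.ne'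
    have : (c : ℂ) ≠ 0 := by exact_mod_cast hHp.ne'
    simp only [Finsupp.smul_apply, smul_eq_mul]
    field_simp
  have hen : ∀ t : ℝ, 0 < t → ‖(t : ℂ)‖ₑ = ENNReal.ofReal t := by
    intro t ht
    rw [← ofReal_norm, Complex.norm_real, Real.norm_of_nonneg ht.le]
  rw [heq, enorm_mul, enorm_mul, enorm_mul, hen a hFp, hen b hGp, hen c hHp]
  calc _ ≤ ENNReal.ofReal a * ENNReal.ofReal b * ENNReal.ofReal c * normB A := by gcongr
    _ = _ := by ring

lemma normB_finset_bound (A : Zn n → Zn n → ℂ) (S R : Finset (Zn n)) (F G H : Zn n → ℂ)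
    (hR : ∀ μ ∈ S, ∀ ν ∈ S, μ + ν ∈ R) :
    ‖∑ μ ∈ S, ∑ ν ∈ S, A μ ν * F μ * G ν * H (μ + ν)‖ₑ ≤
      normB A * ENNReal.ofReal (√(∑ μ ∈ S, ‖F μ‖ ^ 2)) *
        ENNReal.ofReal (√(∑ μ ∈ S, ‖G μ‖ ^ 2)) *
        ENNReal.ofReal (√(∑ μ ∈ R, ‖H μ‖ ^ 2)) := by
  classical
  let cut : Finset (Zn n) → (Zn n → ℂ) → (Zn n →₀ ℂ) := fun S F =>
    Finsupp.onFinset S (fun μ => if μ ∈ S then F μ else 0) (fun μ h => by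
      by_contra hμ; simp [hμ] at h)
  have hcut : ∀ S F, ∀ μ ∈ S, cut S F μ = F μ := by
    intro S F μ hμ; simp [cut, hμ]
  have hsupp : ∀ S F, (cut S F).support ⊆ S := fun S F => Finsupp.support_onFinset_subset
  have hsum : ∀ S F, ∑ μ ∈ (cut S F).support, ‖cut S F μ‖ ^ 2 = ∑ μ ∈ S, ‖F μ‖ ^ 2 := by
    intro S F
    rw [Finset.sum_subset (hsupp S F)]
    · exact Finset.sum_congr rfl fun μ hμ => by rw [hcut S F μ hμ]
    · intro μ _ h; rw [Finsupp.notMem_support_iff.1 h]; simp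
  have h := normB_finsupp_bound A (cut S F) (cut S G) (cut R H)
  rw [hsum, hsum, hsum] at h
  convert! h using 2
  rw [Finset.sum_subset (hsupp S F)]
  · refine Finset.sum_congr rfl fun μ hμ => ?_
    rw [Finset.sum_subset (hsupp S G)]
    · refine Finset.sum_congr rfl fun ν hν => ?_
      rw [hcut S F μ hμ, hcut S G ν hν, hcut R H _ (hR μ hμ ν hν)]
    · intro ν _ h; rw [Finsupp.notMem_support_iff.1 h]; simp
  · intro μ _ h; rw [Finsupp.notMem_support_iff.1 h]; simp

lemma ofReal_sqrt_sum_sq (S : Finset (Zn n)) (F : Zn n → ℂ) :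
    ENNReal.ofReal (√(∑ μ ∈ S, ‖F μ‖ ^ 2)) ^ 2 = ∑ μ ∈ S, ‖F μ‖ₑ ^ 2 := by
  rw [← ENNReal.ofReal_pow (Real.sqrt_nonneg _), Real.sq_sqrt (Finset.sum_nonneg fun _ _ => by
    positivity), ENNReal.ofReal_sum_of_nonneg fun _ _ => by positivity]
  simp_rw [enorm_sq_eq_ofReal]

/-- The form norm controls the `L²` norm of the bilinear trigonometric sums on the unit cube. -/
lemma lintegral_bilinear_trig_le (A : Zn n → Zn n → ℂ) (S : Finset (Zn n)) (F G : Zn n → ℂ) :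
    ∫⁻ y in cube n 1, ‖∑ μ ∈ S, ∑ ν ∈ S, A μ ν * F μ * G ν * chi (coeZ (μ + ν) ⬝ᵥ y)‖ₑ ^ 2 ≤
      normB A ^ 2 * (∑ μ ∈ S, ‖F μ‖ₑ ^ 2) * (∑ μ ∈ S, ‖G μ‖ₑ ^ 2) := by
  classical
  set R : Finset (Zn n) := (S ×ˢ S).image (fun p => p.1 + p.2) with hRdef
  have hR : ∀ μ ∈ S, ∀ ν ∈ S, μ + ν ∈ R := fun μ hμ ν hν =>
    Finset.mem_image.2 ⟨(μ, ν), Finset.mk_mem_product hμ hν, rfl⟩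
  let b : Zn n → ℂ := fun τ => ∑ p ∈ S ×ˢ S with p.1 + p.2 = τ, A p.1 p.2 * F p.1 * G p.2
  have hfib : ∀ w : Zn n → ℂ, ∑ μ ∈ S, ∑ ν ∈ S, A μ ν * F μ * G ν * w (μ + ν) =
      ∑ τ ∈ R, b τ * w τ := by
    intro w
    rw [← Finset.sum_product' S S (fun μ ν => A μ ν * F μ * G ν * w (μ + ν)),
      ← Finset.sum_fiberwise_of_maps_to (s := S ×ˢ S) (t := R) (g := fun p => p.1 + p.2)
        (fun p hp => Finset.mem_image_of_mem _ hp)]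
    refine Finset.sum_congr rfl fun τ _ => ?_
    rw [Finset.sum_mul]
    refine Finset.sum_congr rfl fun p hp => ?_
    rw [(Finset.mem_filter.1 hp).2]
  have h1 : ∀ y : Rn n, ∑ μ ∈ S, ∑ ν ∈ S, A μ ν * F μ * G ν * chi (coeZ (μ + ν) ⬝ᵥ y) =
      ∑ τ ∈ R, b τ * chi (coeZ τ ⬝ᵥ y) := fun y => hfib fun τ => chi (coeZ τ ⬝ᵥ y)
  simp_rw [h1]
  rw [parseval_cube]
  have h2 := normB_finset_bound A S R F G (fun τ => (starRingEnd ℂ) (b τ)) hR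
  rw [hfib (fun τ => (starRingEnd ℂ) (b τ))] at h2
  rw [← ofReal_sqrt_sum_sq, ← ofReal_sqrt_sum_sq, ← ofReal_sqrt_sum_sq, ← mul_pow, ← mul_pow]
  refine pow_le_pow_left₀ (zero_le) ?_ 2
  have h3 : ‖∑ τ ∈ R, b τ * (starRingEnd ℂ) (b τ)‖ₑ =
      ENNReal.ofReal (√(∑ τ ∈ R, ‖b τ‖ ^ 2)) * ENNReal.ofReal (√(∑ τ ∈ R, ‖b τ‖ ^ 2)) := by
    rw [← pow_two, ← ENNReal.ofReal_pow (Real.sqrt_nonneg _),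
      Real.sq_sqrt (Finset.sum_nonneg fun _ _ => by positivity), ← ofReal_norm]
    congr 1
    have : ∑ τ ∈ R, b τ * (starRingEnd ℂ) (b τ) = ((∑ τ ∈ R, ‖b τ‖ ^ 2 : ℝ) : ℂ) := by
      push_cast
      exact Finset.sum_congr rfl fun τ _ => Complex.mul_conj' _
    rw [this, Complex.norm_real, Real.norm_of_nonneg (Finset.sum_nonneg fun _ _ => by positivity)]
  rw [h3] at h2
  simp only [RCLike.norm_conj] at h2
  by_cases h0 : ENNReal.ofReal (√(∑ τ ∈ R, ‖b τ‖ ^ 2)) = 0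
  · rw [h0]; exact zero_le
  · exact (ENNReal.mul_le_mul_iff_left h0 ENNReal.ofReal_ne_top).1 h2

end Trilinear

section Amalgam

variable {n : ℕ}

lemma amalgamNorm_top_le (q : ℝ≥0∞) (hq : 1 ≤ q) (h : Rn n → ℂ) (ν : Zn n) :
    localL2 h ν ≤ amalgamNorm q h := by
  unfold amalgamNorm
  split_ifs with hq'
  · exact le_iSup (fun ν => localL2 h ν) ν
  · have hq0 : 0 < q.toReal := ENNReal.toReal_pos (by positivity) hq'
    calc localL2 h ν = (localL2 h ν ^ q.toReal) ^ (1 / q.toReal) := by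
          rw [← ENNReal.rpow_mul, mul_one_div_cancel hq0.ne', ENNReal.rpow_one]
      _ ≤ _ := by
          gcongr
          exact ENNReal.le_tsum (f := fun ν => localL2 h ν ^ q.toReal) ν

lemma amalgamNorm_le_tsum (q : ℝ≥0∞) (hq : 1 ≤ q) (h : Rn n → ℂ) :
    amalgamNorm q h ≤ ∑' ν : Zn n, localL2 h ν := by
  unfold amalgamNorm
  split_ifs with hq'
  · exact iSup_le fun ν => ENNReal.le_tsum ν
  · have hq1 : 1 ≤ q.toReal := by
      rw [← ENNReal.toReal_one]; exact ENNReal.toReal_mono hq' hq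
    have hq0 : 0 < q.toReal := by linarith
    set X := ∑' ν : Zn n, localL2 h ν
    calc (∑' ν : Zn n, localL2 h ν ^ q.toReal) ^ (1 / q.toReal)
        ≤ (X ^ q.toReal) ^ (1 / q.toReal) := by
          gcongr
          have hsplit : ∀ x : ℝ≥0∞, x ^ q.toReal = x ^ (q.toReal - 1) * x := by
            intro x
            conv_rhs => rw [← ENNReal.rpow_one x, ← ENNReal.rpow_mul, one_mul]
            rw [← ENNReal.rpow_add_of_nonneg _ _ (by linarith) (by norm_num)]
            simp
          calc ∑' ν : Zn n, localL2 h ν ^ q.toReal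
              ≤ ∑' ν : Zn n, X ^ (q.toReal - 1) * localL2 h ν := by
                refine ENNReal.tsum_le_tsum fun ν => ?_
                rw [hsplit]
                gcongr
                exact ENNReal.le_tsum ν
            _ = X ^ q.toReal := by rw [ENNReal.tsum_mul_left, ← hsplit]
      _ = X := by
          rw [← ENNReal.rpow_mul, mul_one_div_cancel hq0.ne', ENNReal.rpow_one]

end Amalgam

section Density

variable {n : ℕ}

instance : Measure.IsAddHaarMeasure (volume : Measure (Rn n × Rn n)) :=
  Measure.prod.instIsAddHaarMeasure (volume : Measure (Fin n → ℝ)) (volume : Measure (Fin n → ℝ))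

/-- `K` is a density writing `Φ` as a superposition of characters, uniformly dominated along
diagonal translates by vectors of the unit cube by the tensor product `ψ ⊗ ψ`. -/
structure IsDensity (Φ K : Rn n × Rn n → ℂ) (ψ : Rn n → ℝ) : Prop where
  integrable_density : Integrable K
  continuous_weight : Continuous ψ
  nonneg : ∀ k, 0 ≤ ψ k
  integrable_weight : Integrable ψ
  bound : ∀ y ∈ cube n 1, ∀ κ : Rn n × Rn n, ‖K (κ.1 - y, κ.2 - y)‖ ≤ ψ κ.1 * ψ κ.2
  rep : ∀ (y : Rn n) (p : Rn n × Rn n), Φ p * chi (y ⬝ᵥ (p.1 + p.2)) =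
    ∫ κ : Rn n × Rn n, K (κ.1 - y, κ.2 - y) * chi (κ.1 ⬝ᵥ p.1 + κ.2 ⬝ᵥ p.2)

lemma exists_isDensity {Φ : Rn n × Rn n → ℂ} (hΦ : IsCcInfty Φ) :
    ∃ K ψ, IsDensity Φ K ψ := by
  obtain ⟨K, hK⟩ := exists_fourier_density hΦ
  set C : ℝ := 2 ^ (2 * (n + 1)) *
    ((Finset.Iic (2 * (n + 1), 0)).sup fun m => SchwartzMap.seminorm ℝ m.1 m.2) K with hC
  have hC0 : 0 ≤ C := by positivity
  have hdecay : ∀ κ, (1 + ‖κ‖) ^ (2 * (n + 1)) * ‖K κ‖ ≤ C := by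
    intro κ
    have := SchwartzMap.one_add_le_sup_seminorm_apply (𝕜 := ℝ) (m := (2 * (n + 1), 0)) le_rfl
      le_rfl K κ
    simpa using this
  set ψ : Rn n → ℝ := fun k => √C * 2 ^ (n + 1) * (1 + ‖k‖) ^ (-((n + 1 : ℕ) : ℝ)) with hψ
  refine ⟨K, ψ, K.integrable, ?_, fun k => by positivity, ?_, ?_, ?_⟩
  · refine continuous_const.mul (Continuous.rpow_const (by fun_prop) fun k => Or.inl ?_)
    positivity
  · refine Integrable.const_mul (integrable_one_add_norm ?_) _
    simp
  · intro y hy κ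
    have hyn := cube_norm_le hy
    have h1 : ∀ k : Rn n, 1 + ‖k‖ ≤ 2 * (1 + ‖k - y‖) := by
      intro k
      have := norm_add_le (k - y) y
      rw [sub_add_cancel] at this
      linarith [norm_nonneg (k - y)]
    have h2 : (1 + ‖κ.1‖) * (1 + ‖κ.2‖) ≤ 4 * (1 + ‖(κ.1 - y, κ.2 - y)‖) ^ 2 := by
      have ha : ‖κ.1 - y‖ ≤ ‖(κ.1 - y, κ.2 - y)‖ := norm_fst_le (κ.1 - y, κ.2 - y)
      have hb : ‖κ.2 - y‖ ≤ ‖(κ.1 - y, κ.2 - y)‖ := norm_snd_le (κ.1 - y, κ.2 - y)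
      calc (1 + ‖κ.1‖) * (1 + ‖κ.2‖) ≤ (2 * (1 + ‖κ.1 - y‖)) * (2 * (1 + ‖κ.2 - y‖)) :=
            mul_le_mul (h1 _) (h1 _) (by positivity) (by positivity)
        _ ≤ (2 * (1 + ‖(κ.1 - y, κ.2 - y)‖)) * (2 * (1 + ‖(κ.1 - y, κ.2 - y)‖)) := by gcongr
        _ = _ := by ring
    have h3 : ψ κ.1 * ψ κ.2 = C * 4 ^ (n + 1) / ((1 + ‖κ.1‖) * (1 + ‖κ.2‖)) ^ (n + 1) := by
      simp only [hψ]
      rw [Real.rpow_neg (by positivity), Real.rpow_neg (by positivity), Real.rpow_natCast,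
        Real.rpow_natCast, mul_pow]
      have hs : √C * √C = C := Real.mul_self_sqrt hC0
      have h4 : (4 : ℝ) ^ (n + 1) = 2 ^ (n + 1) * 2 ^ (n + 1) := by rw [← mul_pow]; norm_num
      rw [h4]
      conv_rhs => rw [← hs]
      field_simp
    rw [h3, le_div_iff₀ (by positivity)]
    calc ‖K (κ.1 - y, κ.2 - y)‖ * ((1 + ‖κ.1‖) * (1 + ‖κ.2‖)) ^ (n + 1)
        ≤ ‖K (κ.1 - y, κ.2 - y)‖ * (4 * (1 + ‖(κ.1 - y, κ.2 - y)‖) ^ 2) ^ (n + 1) := by gcongr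
      _ = ((1 + ‖(κ.1 - y, κ.2 - y)‖) ^ (2 * (n + 1)) * ‖K (κ.1 - y, κ.2 - y)‖) * 4 ^ (n + 1) := by
          rw [mul_pow, ← pow_mul]; ring
      _ ≤ C * 4 ^ (n + 1) := by gcongr; exact hdecay _
  · intro y p
    rw [hK p, ← integral_sub_right_eq_self
      (fun κ : Rn n × Rn n => K κ * chi (κ.1 ⬝ᵥ p.1 + κ.2 ⬝ᵥ p.2)) (y, y), ← integral_mul_const]
    congr 1
    ext κ
    have : κ.1 ⬝ᵥ p.1 + κ.2 ⬝ᵥ p.2 = ((κ - (y, y)).1 ⬝ᵥ p.1 + (κ - (y, y)).2 ⬝ᵥ p.2) +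
        y ⬝ᵥ (p.1 + p.2) := by
      simp only [Prod.fst_sub, Prod.snd_sub, sub_dotProduct, dotProduct_add]
      ring
    rw [this, chi_add (_ + _) (y ⬝ᵥ _), ← mul_assoc]
    rfl

end Density

section Cutoff

variable {n : ℕ}

/-- A smooth compactly supported cutoff with values in `[0, 1]` whose lattice translates have
bounded overlap. -/
structure IsCutoff (φ : Rn n → ℝ) (D : ℝ≥0) : Prop where
  contDiff : ContDiff ℝ (⊤ : ℕ∞) φ
  compact : HasCompactSupport φ
  nonneg : ∀ x, 0 ≤ φ x
  le_one : ∀ x, φ x ≤ 1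
  tsum_le : ∀ x, ∑' τ : Zn n, ENNReal.ofReal (φ (x - coeZ τ)) ≤ D

lemma exists_isCutoff (n : ℕ) (r : ℝ) :
    ∃ φ : Rn n → ℝ, ∃ D : ℝ≥0, IsCutoff φ D ∧ ∀ x, ‖x‖ ≤ r → φ x = 1 := by
  classical
  let b : ContDiffBump (0 : Rn n) := ⟨|r| + 1, |r| + 2, by positivity, by linarith⟩
  let m : ℤ := ⌈|r| + 3⌉
  let Z : Finset (Zn n) := Fintype.piFinset fun _ => Finset.Icc (-m) m
  refine ⟨b, (Z.card : ℝ≥0), ⟨b.contDiff, b.hasCompactSupport, fun x => b.nonneg,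
    fun x => b.le_one, fun x => ?_⟩, fun x hx => ?_⟩
  · rw [ENNReal.tsum_eq_iSup_sum]
    refine iSup_le fun S => ?_
    have hz : ∀ τ, b (x - coeZ τ) ≠ 0 → τ - (fun i => round (x i)) ∈ Z := by
      intro τ hτ
      have h1 : x - coeZ τ ∈ Metric.ball (0 : Rn n) (|r| + 2) := by
        have : x - coeZ τ ∈ Function.support b := hτ
        rwa [b.support_eq] at this
      rw [mem_ball_zero_iff] at h1
      refine Fintype.mem_piFinset.2 fun i => ?_
      have h2 : |x i - τ i| < |r| + 2 := (norm_le_pi_norm (x - coeZ τ) i).trans_lt h1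
      have h3 := abs_sub_round (x i)
      have h4 : |((τ i - round (x i) : ℤ) : ℝ)| ≤ m := by
        have : |r| + 3 ≤ (m : ℝ) := Int.le_ceil _
        rw [abs_le] at *
        rw [abs_lt] at h2
        push_cast
        constructor <;> linarith [h2.1, h2.2, h3.1, h3.2]
      have h5 : |τ i - round (x i)| ≤ m := by exact_mod_cast h4
      rw [abs_le] at h5
      simpa using h5
    calc ∑ τ ∈ S, ENNReal.ofReal (b (x - coeZ τ))
        = ∑ τ ∈ S with b (x - coeZ τ) ≠ 0, ENNReal.ofReal (b (x - coeZ τ)) := by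
          rw [Finset.sum_filter_of_ne]
          intro τ _ h h0
          simp [h0] at h
      _ ≤ ∑ τ ∈ S with b (x - coeZ τ) ≠ 0, 1 :=
          Finset.sum_le_sum fun τ _ => ENNReal.ofReal_le_one.2 b.le_one
      _ ≤ (Z.card : ℝ≥0) := by
          rw [Finset.sum_const, nsmul_eq_mul, mul_one]
          have : (S.filter fun τ => b (x - coeZ τ) ≠ 0).card ≤ Z.card :=
            Finset.card_le_card_of_injOn (fun τ => τ - fun i => round (x i))
              (fun τ hτ => hz τ (Finset.mem_filter.1 hτ).2) (sub_left_injective.injOn)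
          push_cast
          exact_mod_cast this
  · refine b.one_of_mem_closedBall ?_
    rw [mem_closedBall_zero_iff]
    have := le_abs_self r
    change ‖x‖ ≤ |r| + 1
    linarith

lemma exists_cutoff_of_hasCompactSupport {Φ Θ : Rn n × Rn n → ℂ} (hΦ : HasCompactSupport Φ)
    (hΘ : HasCompactSupport Θ) : ∃ φ : Rn n → ℝ, ∃ D : ℝ≥0, IsCutoff φ D ∧
      (∀ p, Φ p ≠ 0 → φ p.1 = 1 ∧ φ p.2 = 1) ∧ (∀ p, Θ p ≠ 0 → φ p.1 = 1 ∧ φ p.2 = 1) := by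
  obtain ⟨r, hr⟩ := (hΦ.isCompact.union hΘ.isCompact).isBounded.exists_norm_le
  obtain ⟨φ, D, hφ, h1⟩ := exists_isCutoff n r
  refine ⟨φ, D, hφ, fun p hp => ?_, fun p hp => ?_⟩
  · have := hr p (Or.inl (subset_tsupport _ hp))
    exact ⟨h1 _ ((norm_fst_le p).trans this), h1 _ ((norm_snd_le p).trans this)⟩
  · have := hr p (Or.inr (subset_tsupport _ hp))
    exact ⟨h1 _ ((norm_fst_le p).trans this), h1 _ ((norm_snd_le p).trans this)⟩

lemma IsCutoff.tsum_add_le {φ : Rn n → ℝ} {D : ℝ≥0} (hφ : IsCutoff φ D) (x : Rn n) :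
    ∑' τ : Zn n, ENNReal.ofReal (φ (x + coeZ τ)) ≤ D := by
  rw [← (Equiv.neg (Zn n)).tsum_eq]
  simpa [coeZ_neg, ← sub_eq_add_neg] using hφ.tsum_le x

lemma IsCutoff.enorm_eq {φ : Rn n → ℝ} {D : ℝ≥0} (hφ : IsCutoff φ D) (x : Rn n) :
    ‖(φ x : ℂ)‖ₑ = ENNReal.ofReal (φ x) := by
  rw [← ofReal_norm, Complex.norm_real, Real.norm_of_nonneg (hφ.nonneg x)]

end Cutoff

section CauchySchwarz

lemma lintegral_weight_mul_sq_le {α : Type*} [MeasurableSpace α] (μ : Measure α)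
    {w f g : α → ℝ≥0∞} (hw : AEMeasurable w μ) (hf : AEMeasurable f μ) (hg : AEMeasurable g μ) :
    (∫⁻ x, w x * f x * g x ∂μ) ^ 2 ≤ (∫⁻ x, w x * f x ^ 2 ∂μ) * ∫⁻ x, w x * g x ^ 2 ∂μ := by
  have hsq : ∀ x : ℝ≥0∞, (x ^ (1 / 2 : ℝ)) ^ (2 : ℕ) = x := by
    intro x
    rw [← ENNReal.rpow_natCast, ← ENNReal.rpow_mul]
    norm_num
  have h := ENNReal.lintegral_mul_le_Lp_mul_Lq μ Real.HolderConjugate.two_two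
    ((hw.pow_const (1 / 2 : ℝ)).mul hf) ((hw.pow_const (1 / 2 : ℝ)).mul hg)
  have e1 : ∀ x, ((fun x => w x ^ (1 / 2 : ℝ)) * f * ((fun x => w x ^ (1 / 2 : ℝ)) * g)) x =
      w x * f x * g x := by
    intro x
    simp only [Pi.mul_apply]
    calc _ = (w x ^ (1 / 2 : ℝ)) ^ 2 * f x * g x := by ring
      _ = _ := by rw [hsq]
  have e2 : ∀ f : α → ℝ≥0∞, ∀ x, ((fun x => w x ^ (1 / 2 : ℝ)) * f) x ^ (2 : ℝ) =
      w x * f x ^ 2 := by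
    intro f x
    rw [Pi.mul_apply, ENNReal.rpow_two, mul_pow, hsq]
  simp only [e1, e2] at h
  calc _ ≤ _ := pow_le_pow_left₀ zero_le h 2
    _ = _ := by rw [mul_pow, hsq, hsq]

end CauchySchwarz

section Superposition

variable {n : ℕ}

lemma IsDensity.integrable_shift {Φ K : Rn n × Rn n → ℂ} {ψ : Rn n → ℝ} (h : IsDensity Φ K ψ)
    (y : Rn n) : Integrable fun κ : Rn n × Rn n => K (κ.1 - y, κ.2 - y) :=
  h.integrable_density.comp_sub_right (y, y)

lemma IsDensity.lintegral_weight_lt_top {Φ K : Rn n × Rn n → ℂ} {ψ : Rn n → ℝ}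
    (h : IsDensity Φ K ψ) : ∫⁻ k, ENNReal.ofReal (ψ k) < ∞ := by
  rw [← ofReal_integral_eq_lintegral_ofReal h.integrable_weight
    (Filter.Eventually.of_forall h.nonneg)]
  exact ENNReal.ofReal_lt_top

lemma IsDensity.enorm_le {Φ K : Rn n × Rn n → ℂ} {ψ : Rn n → ℝ} (h : IsDensity Φ K ψ)
    {y : Rn n} (hy : y ∈ cube n 1) (κ : Rn n × Rn n) :
    ‖K (κ.1 - y, κ.2 - y)‖ₑ ≤ ENNReal.ofReal (ψ κ.1) * ENNReal.ofReal (ψ κ.2) := by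
  rw [← ENNReal.ofReal_mul (h.nonneg _), ← ofReal_norm]
  exact ENNReal.ofReal_le_ofReal (h.bound y hy κ)

lemma lintegral_prod_mul_self (w : Rn n → ℝ≥0∞) (hw : Measurable w) :
    ∫⁻ κ : Rn n × Rn n, w κ.1 * w κ.2 = (∫⁻ k, w k) ^ 2 := by
  rw [Measure.volume_eq_prod, lintegral_prod_mul hw.aemeasurable hw.aemeasurable, sq]

/-- Fubini's theorem for superpositions of dominated tensor products. -/
lemma integral_superposition_swap {s K : Rn n × Rn n → ℂ} {U V : Rn n → Rn n → ℂ}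
    {u v : Rn n → ℝ} {C : ℝ} (hs : AEStronglyMeasurable s) (hsC : ∀ p, ‖s p‖ ≤ C)
    (hK : Integrable K) (hU : Continuous (Function.uncurry U))
    (hV : Continuous (Function.uncurry V)) (hu : Integrable u) (hv : Integrable v)
    (hUu : ∀ k ξ, ‖U k ξ‖ ≤ u ξ) (hVv : ∀ k ξ, ‖V k ξ‖ ≤ v ξ) :
    ∫ p : Rn n × Rn n, s p * ∫ κ : Rn n × Rn n, K κ * (U κ.1 p.1 * V κ.2 p.2) =
      ∫ κ : Rn n × Rn n, K κ * ∫ p : Rn n × Rn n, s p * (U κ.1 p.1 * V κ.2 p.2) := by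
  simp_rw [← integral_const_mul]
  rw [integral_integral_swap]
  · refine integral_congr_ae (Filter.Eventually.of_forall fun κ => ?_)
    refine integral_congr_ae (Filter.Eventually.of_forall fun p => ?_)
    simp only
    ring
  · have hdom : Integrable (fun z : (Rn n × Rn n) × (Rn n × Rn n) =>
        (C * (u z.1.1 * v z.1.2)) * ‖K z.2‖) (volume.prod volume) :=
      ((hu.mul_prod hv).const_mul C).mul_prod hK.norm
    refine hdom.mono' ?_ (Filter.Eventually.of_forall fun z => ?_)
    · have hU' : Continuous fun z : (Rn n × Rn n) × (Rn n × Rn n) => U z.2.1 z.1.1 :=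
        hU.comp (f := fun z : (Rn n × Rn n) × (Rn n × Rn n) => (z.2.1, z.1.1)) (by fun_prop)
      have hV' : Continuous fun z : (Rn n × Rn n) × (Rn n × Rn n) => V z.2.2 z.1.2 :=
        hV.comp (f := fun z : (Rn n × Rn n) × (Rn n × Rn n) => (z.2.2, z.1.2)) (by fun_prop)
      exact hs.comp_fst.mul
        (hK.aestronglyMeasurable.comp_snd.mul (hU'.mul hV').aestronglyMeasurable)
    · simp only [Function.uncurry, norm_mul]
      calc ‖s z.1‖ * (‖K z.2‖ * (‖U z.2.1 z.1.1‖ * ‖V z.2.2 z.1.2‖))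
          ≤ C * (‖K z.2‖ * (u z.1.1 * v z.1.2)) := by
            gcongr
            · exact (norm_nonneg _).trans (hsC z.1)
            · exact hsC _
            · exact (norm_nonneg _).trans (hUu z.2.1 _)
            · exact hUu _ _
            · exact hVv _ _
        _ = _ := by ring

end Superposition

section Coefficients

variable {n : ℕ}

/-- The integrand of the windowed Fourier coefficient. -/
noncomputable def windowed (φ : Rn n → ℝ) (u : Rn n → ℂ) (ρ μ : Zn n) (ξ : Rn n) : ℂ :=
  chi (coeZ ρ ⬝ᵥ ξ) * φ (ξ - coeZ μ) * u ξ

/-- The windowed Fourier coefficient of `u` at position `μ`, frequency `ρ` and phase `k`. -/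
noncomputable def coef (φ : Rn n → ℝ) (u : Rn n → ℂ) (ρ : Zn n) (k : Rn n) (μ : Zn n) : ℂ :=
  ∫ ξ, chi (k ⬝ᵥ (ξ - coeZ μ)) * windowed φ u ρ μ ξ

variable {φ : Rn n → ℝ} {D : ℝ≥0} {u v : Rn n → ℂ}

lemma IsCutoff.continuous (hφ : IsCutoff φ D) : Continuous φ := hφ.contDiff.continuous

lemma IsCutoff.continuous_windowed (hφ : IsCutoff φ D) (hu : Continuous u) (ρ μ : Zn n) :
    Continuous (windowed φ u ρ μ) := by
  have h1 := hφ.continuous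
  have h2 := continuous_chi
  unfold windowed
  fun_prop

lemma IsCutoff.norm_windowed_le (hφ : IsCutoff φ D) (ρ μ : Zn n) (ξ : Rn n) :
    ‖windowed φ u ρ μ ξ‖ ≤ ‖u ξ‖ := by
  rw [windowed, norm_mul, norm_mul, norm_chi, one_mul, Complex.norm_real,
    Real.norm_of_nonneg (hφ.nonneg _)]
  exact mul_le_of_le_one_left (norm_nonneg _) (hφ.le_one _)

lemma IsCutoff.norm_coef_integrand_le (hφ : IsCutoff φ D) (ρ μ : Zn n) (k ξ : Rn n) :
    ‖chi (k ⬝ᵥ (ξ - coeZ μ)) * windowed φ u ρ μ ξ‖ ≤ ‖u ξ‖ := by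
  rw [norm_mul, norm_chi, one_mul]
  exact hφ.norm_windowed_le ρ μ ξ

lemma IsCutoff.continuous_coef_integrand (hφ : IsCutoff φ D) (hu : Continuous u) (ρ μ : Zn n) :
    Continuous (Function.uncurry fun k ξ => chi (k ⬝ᵥ (ξ - coeZ μ)) * windowed φ u ρ μ ξ) := by
  have h1 := hφ.continuous_windowed hu ρ μ
  have h2 := continuous_chi
  unfold Function.uncurry
  fun_prop

lemma IsCutoff.integrable_coef_integrand (hφ : IsCutoff φ D) (hu : Continuous u)
    (hui : Integrable u) (ρ μ : Zn n) (k : Rn n) :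
    Integrable fun ξ => chi (k ⬝ᵥ (ξ - coeZ μ)) * windowed φ u ρ μ ξ := by
  refine hui.norm.mono' ?_ (Filter.Eventually.of_forall (hφ.norm_coef_integrand_le ρ μ k))
  exact ((hφ.continuous_coef_integrand hu ρ μ).comp (f := fun ξ => (k, ξ))
    (by fun_prop)).aestronglyMeasurable

lemma IsCutoff.continuous_coef (hφ : IsCutoff φ D) (hu : Continuous u) (hui : Integrable u)
    (ρ μ : Zn n) : Continuous fun k => coef φ u ρ k μ := by
  refine continuous_of_dominated
    (fun k => (hφ.integrable_coef_integrand hu hui ρ μ k).aestronglyMeasurable)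
    (fun k => Filter.Eventually.of_forall (hφ.norm_coef_integrand_le ρ μ k)) hui.norm
    (Filter.Eventually.of_forall fun ξ => ?_)
  exact (hφ.continuous_coef_integrand hu ρ μ).comp (f := fun k => (k, ξ)) (by fun_prop)

lemma IsCutoff.norm_coef_le (hφ : IsCutoff φ D) (hui : Integrable u)
    (ρ μ : Zn n) (k : Rn n) : ‖coef φ u ρ k μ‖ ≤ ∫ ξ, ‖u ξ‖ :=
  norm_integral_le_of_norm_le hui.norm
    (Filter.Eventually.of_forall (hφ.norm_coef_integrand_le ρ μ k))

/-- Periodization of a cutoff against a trigonometric polynomial. -/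
lemma IsCutoff.lintegral_mul_trig_le (hφ : IsCutoff φ D) (μ : Zn n) (R : Finset (Zn n))
    (c : Zn n → ℂ) :
    ∫⁻ ξ, ENNReal.ofReal (φ (ξ - coeZ μ)) * ‖∑ τ ∈ R, c τ * chi (coeZ τ ⬝ᵥ ξ)‖ₑ ^ 2 ≤
      D * ∑ τ ∈ R, ‖c τ‖ₑ ^ 2 := by
  have h1 := hφ.continuous.measurable
  have hc := continuous_chi
  have hcm : Measurable fun y : Rn n => ‖∑ τ ∈ R, c τ * chi (coeZ τ ⬝ᵥ y)‖ₑ ^ 2 := by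
    have : Continuous fun y : Rn n => ∑ τ ∈ R, c τ * chi (coeZ τ ⬝ᵥ y) := by fun_prop
    exact this.enorm.measurable.pow_const 2
  refine (lintegral_le_tsum_cube _).trans ?_
  have hper : ∀ (σ : Zn n) (y : Rn n), ∑ τ ∈ R, c τ * chi (coeZ τ ⬝ᵥ (y + coeZ σ)) =
      ∑ τ ∈ R, c τ * chi (coeZ τ ⬝ᵥ y) := by
    intro σ y
    refine Finset.sum_congr rfl fun τ _ => ?_
    rw [dotProduct_add, chi_add, coeZ_dot, chi_int, mul_one]
  simp_rw [hper]
  rw [← lintegral_tsum fun τ => by fun_prop]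
  simp_rw [ENNReal.tsum_mul_right]
  calc _ ≤ ∫⁻ y in cube n 1, D * ‖∑ τ ∈ R, c τ * chi (coeZ τ ⬝ᵥ y)‖ₑ ^ 2 := by
        refine lintegral_mono fun y => ?_
        gcongr
        have := hφ.tsum_add_le (y - coeZ μ)
        simpa [add_sub_right_comm] using this
    _ = _ := by rw [lintegral_const_mul _ hcm, parseval_cube]

/-- Bessel's inequality for the windowed Fourier coefficients. -/
lemma IsCutoff.sum_coef_sq_le (hφ : IsCutoff φ D) (hu : Continuous u) (hui : Integrable u)
    (k : Rn n) (μ : Zn n) (R : Finset (Zn n)) :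
    ∑ ρ ∈ R, ‖coef φ u ρ k μ‖ₑ ^ 2 ≤
      D * ∫⁻ ξ, ENNReal.ofReal (φ (ξ - coeZ μ)) * ‖u ξ‖ₑ ^ 2 := by
  have hφm := hφ.continuous.measurable
  have hc := continuous_chi
  set X : ℝ≥0∞ := ∑ ρ ∈ R, ‖coef φ u ρ k μ‖ₑ ^ 2 with hX
  set c : Zn n → ℂ := fun ρ => (starRingEnd ℂ) (coef φ u ρ k μ) with hcdef
  have hXtop : X ≠ ∞ := by
    rw [hX, ENNReal.sum_ne_top]
    intro ρ _
    exact ENNReal.pow_ne_top enorm_ne_top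
  have hcX : ∑ ρ ∈ R, ‖c ρ‖ₑ ^ 2 = X := by
    refine Finset.sum_congr rfl fun ρ _ => ?_
    rw [← ofReal_norm, ← ofReal_norm, hcdef]
    simp only [RCLike.norm_conj]
  have hP : Continuous fun ξ : Rn n => ∑ τ ∈ R, c τ * chi (coeZ τ ⬝ᵥ ξ) := by fun_prop
  have hdual : (∑ ρ ∈ R, c ρ * coef φ u ρ k μ) = ∫ ξ, chi (k ⬝ᵥ (ξ - coeZ μ)) *
      (φ (ξ - coeZ μ) * u ξ * ∑ τ ∈ R, c τ * chi (coeZ τ ⬝ᵥ ξ)) := by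
    simp_rw [coef, ← integral_const_mul]
    rw [← integral_finsetSum]
    · refine integral_congr_ae (Filter.Eventually.of_forall fun ξ => ?_)
      simp only [windowed, Finset.mul_sum]
      refine Finset.sum_congr rfl fun ρ _ => ?_
      ring
    · exact fun ρ _ => (hφ.integrable_coef_integrand hu hui ρ μ k).const_mul _
  have hXle : X ≤ ∫⁻ ξ, ENNReal.ofReal (φ (ξ - coeZ μ)) * ‖u ξ‖ₑ *
      ‖∑ τ ∈ R, c τ * chi (coeZ τ ⬝ᵥ ξ)‖ₑ := by
    have h1 : X = ‖∑ ρ ∈ R, c ρ * coef φ u ρ k μ‖ₑ := by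
      have : ∑ ρ ∈ R, c ρ * coef φ u ρ k μ = ((∑ ρ ∈ R, ‖coef φ u ρ k μ‖ ^ 2 : ℝ) : ℂ) := by
        push_cast
        refine Finset.sum_congr rfl fun ρ _ => ?_
        rw [hcdef]
        exact RCLike.conj_mul _
      rw [this, ← ofReal_norm, Complex.norm_real, Real.norm_of_nonneg (by positivity),
        ENNReal.ofReal_sum_of_nonneg (fun _ _ => by positivity)]
      exact Finset.sum_congr rfl fun ρ _ => enorm_sq_eq_ofReal _
    rw [h1, hdual]
    refine (enorm_integral_le_lintegral_enorm _).trans (lintegral_mono fun ξ => ?_)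
    rw [enorm_mul, enorm_mul, enorm_mul, hφ.enorm_eq, ← ofReal_norm, norm_chi]
    simp [mul_assoc]
  have hsq : X ^ 2 ≤ (∫⁻ ξ, ENNReal.ofReal (φ (ξ - coeZ μ)) * ‖u ξ‖ₑ ^ 2) * (D * X) := by
    calc X ^ 2 ≤ _ := pow_le_pow_left₀ zero_le hXle 2
      _ ≤ _ := lintegral_weight_mul_sq_le volume (by fun_prop) hu.enorm.measurable.aemeasurable
          hP.enorm.measurable.aemeasurable
      _ ≤ _ := by
        gcongr
        rw [← hcX]
        exact hφ.lintegral_mul_trig_le μ R c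
  rcases eq_or_ne X 0 with h0 | h0
  · rw [h0]; exact zero_le
  · rw [sq, ← mul_assoc, mul_comm _ (D : ℝ≥0∞)] at hsq
    exact (ENNReal.mul_le_mul_iff_left h0 hXtop).1 hsq

lemma IsCutoff.tsum_coef_sq_le (hφ : IsCutoff φ D) (hu : Continuous u) (hui : Integrable u)
    (k : Rn n) :
    ∑' ρ, ∑' μ, ‖coef φ u ρ k μ‖ₑ ^ 2 ≤ (D : ℝ≥0∞) ^ 2 * ∫⁻ ξ, ‖u ξ‖ₑ ^ 2 := by
  have hφm := hφ.continuous.measurable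
  have hum : Measurable fun ξ => ‖u ξ‖ₑ ^ 2 := hu.enorm.measurable.pow_const 2
  rw [ENNReal.tsum_comm]
  calc ∑' μ, ∑' ρ, ‖coef φ u ρ k μ‖ₑ ^ 2
      ≤ ∑' μ : Zn n, D * ∫⁻ ξ, ENNReal.ofReal (φ (ξ - coeZ μ)) * ‖u ξ‖ₑ ^ 2 := by
        refine ENNReal.tsum_le_tsum fun μ => ?_
        rw [ENNReal.tsum_eq_iSup_sum]
        exact iSup_le fun R => hφ.sum_coef_sq_le hu hui k μ R
    _ = D * ∫⁻ ξ, (∑' μ : Zn n, ENNReal.ofReal (φ (ξ - coeZ μ))) * ‖u ξ‖ₑ ^ 2 := by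
        rw [ENNReal.tsum_mul_left, ← lintegral_tsum fun τ => by fun_prop]
        simp_rw [ENNReal.tsum_mul_right]
    _ ≤ D * ∫⁻ ξ, D * ‖u ξ‖ₑ ^ 2 := by
        gcongr with ξ
        exact hφ.tsum_le ξ
    _ = _ := by rw [lintegral_const_mul _ hum, sq, mul_assoc]

end Coefficients

section Truncation

variable {n : ℕ} {Φ K : Rn n × Rn n → ℂ} {ψ φ : Rn n → ℝ} {D : ℝ≥0} {u v : Rn n → ℂ}

/-- The bilinear operator of `Tbil` with the Fourier transforms replaced by arbitrary
functions. -/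
noncomputable def Tgen (σ : Rn n × Rn n → ℂ) (u v : Rn n → ℂ) (x : Rn n) : ℂ :=
  ∫ p : Rn n × Rn n, chi (x ⬝ᵥ (p.1 + p.2)) * σ p * u p.1 * v p.2

lemma Tbil_eq_Tgen (σ : Rn n × Rn n → ℂ) (f g : 𝓢(Rn n, ℂ)) :
    Tbil σ f g = Tgen σ (ft f) (ft g) := rfl

/-- Truncation of the multiplier `sigmaA` to a finite set of lattice points. -/
noncomputable def sigmaFin (A : Zn n → Zn n → ℂ) (Φ : Rn n × Rn n → ℂ) (S : Finset (Zn n))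
    (p : Rn n × Rn n) : ℂ :=
  ∑ μ ∈ S, ∑ ν ∈ S, A μ ν * Φ (p.1 - coeZ μ, p.2 - coeZ ν)

lemma Tgen_translate_eq (h : IsDensity Φ K ψ) (hφ : IsCutoff φ D)
    (hΦφ : ∀ p, Φ p ≠ 0 → φ p.1 = 1 ∧ φ p.2 = 1) (hu : Continuous u) (hv : Continuous v)
    (hui : Integrable u) (hvi : Integrable v) (μ ν ρ : Zn n) (y : Rn n) :
    Tgen (fun p => Φ (p.1 - coeZ μ, p.2 - coeZ ν)) u v (y + coeZ ρ) =
      chi (coeZ (μ + ν) ⬝ᵥ y) * ∫ κ : Rn n × Rn n,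
        K (κ.1 - y, κ.2 - y) * (coef φ u ρ κ.1 μ * coef φ v ρ κ.2 ν) := by
  have hsw := integral_superposition_swap (s := fun _ => 1)
    (U := fun k ξ => chi (k ⬝ᵥ (ξ - coeZ μ)) * windowed φ u ρ μ ξ)
    (V := fun k ξ => chi (k ⬝ᵥ (ξ - coeZ ν)) * windowed φ v ρ ν ξ) (C := 1)
    aestronglyMeasurable_const (by simp) (h.integrable_shift y)
    (hφ.continuous_coef_integrand hu ρ μ) (hφ.continuous_coef_integrand hv ρ ν) hui.norm hvi.norm
    (hφ.norm_coef_integrand_le ρ μ) (hφ.norm_coef_integrand_le ρ ν)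
  have hcoef : ∀ κ : Rn n × Rn n, ∫ p : Rn n × Rn n,
      (fun _ => (1 : ℂ)) p * ((chi (κ.1 ⬝ᵥ (p.1 - coeZ μ)) * windowed φ u ρ μ p.1) *
        (chi (κ.2 ⬝ᵥ (p.2 - coeZ ν)) * windowed φ v ρ ν p.2)) =
      coef φ u ρ κ.1 μ * coef φ v ρ κ.2 ν := by
    intro κ
    simp only [one_mul]
    rw [Measure.volume_eq_prod, integral_prod_mul
      (fun ξ => chi (κ.1 ⬝ᵥ (ξ - coeZ μ)) * windowed φ u ρ μ ξ)
      (fun ξ => chi (κ.2 ⬝ᵥ (ξ - coeZ ν)) * windowed φ v ρ ν ξ)]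
    rfl
  simp_rw [hcoef] at hsw
  rw [← hsw, ← integral_const_mul, Tgen]
  refine integral_congr_ae (Filter.Eventually.of_forall fun p => ?_)
  simp only [one_mul]
  have hrep := h.rep y (p.1 - coeZ μ, p.2 - coeZ ν)
  simp only at hrep
  have hfac : ∫ κ : Rn n × Rn n, K (κ.1 - y, κ.2 - y) *
      (chi (κ.1 ⬝ᵥ (p.1 - coeZ μ)) * windowed φ u ρ μ p.1 *
        (chi (κ.2 ⬝ᵥ (p.2 - coeZ ν)) * windowed φ v ρ ν p.2)) =
      Φ (p.1 - coeZ μ, p.2 - coeZ ν) * chi (y ⬝ᵥ (p.1 - coeZ μ + (p.2 - coeZ ν))) *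
        (windowed φ u ρ μ p.1 * windowed φ v ρ ν p.2) := by
    rw [hrep, ← integral_mul_const]
    refine integral_congr_ae (Filter.Eventually.of_forall fun κ => ?_)
    simp only [chi_add]
    ring
  rw [hfac]
  have hch : chi ((y + coeZ ρ) ⬝ᵥ (p.1 + p.2)) = chi (coeZ (μ + ν) ⬝ᵥ y) *
      chi (y ⬝ᵥ (p.1 - coeZ μ + (p.2 - coeZ ν))) * chi (coeZ ρ ⬝ᵥ p.1) * chi (coeZ ρ ⬝ᵥ p.2) := by
    simp_rw [← chi_add]
    congr 1
    rw [coeZ_add, dotProduct_comm (coeZ μ + coeZ ν) y]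
    simp only [add_dotProduct, dotProduct_add, dotProduct_sub]
    ring
  rw [hch]
  by_cases h0 : Φ (p.1 - coeZ μ, p.2 - coeZ ν) = 0
  · simp [h0]
  · have := hΦφ _ h0
    simp only at this
    simp only [windowed, this.1, this.2]
    push_cast
    ring

lemma integrable_translate (hΦ : IsCcInfty Φ) (hu : Continuous u) (hv : Continuous v)
    (hui : Integrable u) (hvi : Integrable v) (μ ν : Zn n) (x : Rn n) :
    Integrable fun p : Rn n × Rn n => chi (x ⬝ᵥ (p.1 + p.2)) *
      Φ (p.1 - coeZ μ, p.2 - coeZ ν) * u p.1 * v p.2 := by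
  obtain ⟨C, hC⟩ := hΦ.2.exists_bound_of_continuous hΦ.1.continuous
  have hc := continuous_chi
  have hΦc := hΦ.1.continuous
  refine ((hui.norm.mul_prod hvi.norm).const_mul C).mono' ?_
    (Filter.Eventually.of_forall fun p => ?_)
  · refine Continuous.aestronglyMeasurable ?_
    fun_prop
  · rw [norm_mul, norm_mul, norm_mul, norm_chi, one_mul, mul_assoc]
    gcongr
    exact hC _

lemma Tgen_sigmaFin (hΦ : IsCcInfty Φ) (hu : Continuous u) (hv : Continuous v)
    (hui : Integrable u) (hvi : Integrable v) (A : Zn n → Zn n → ℂ) (S : Finset (Zn n))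
    (x : Rn n) :
    Tgen (sigmaFin A Φ S) u v x = ∑ μ ∈ S, ∑ ν ∈ S,
      A μ ν * Tgen (fun p => Φ (p.1 - coeZ μ, p.2 - coeZ ν)) u v x := by
  simp only [Tgen, ← integral_const_mul]
  have hi : ∀ μ ν : Zn n, Integrable fun p : Rn n × Rn n => A μ ν * (chi (x ⬝ᵥ (p.1 + p.2)) *
      Φ (p.1 - coeZ μ, p.2 - coeZ ν) * u p.1 * v p.2) := fun μ ν =>
    (integrable_translate hΦ hu hv hui hvi μ ν x).const_mul _
  rw [← Finset.sum_congr rfl fun μ _ => integral_finsetSum S fun ν _ => hi μ ν,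
    ← integral_finsetSum S fun μ _ => integrable_finsetSum S fun ν _ => hi μ ν]
  refine integral_congr_ae (Filter.Eventually.of_forall fun p => ?_)
  simp only [sigmaFin, Finset.mul_sum, Finset.sum_mul]
  refine Finset.sum_congr rfl fun μ _ => Finset.sum_congr rfl fun ν _ => ?_
  ring

/-- The weighted square sum of the windowed Fourier coefficients of frequency `ρ`. -/
noncomputable def coefEnergy (ψ φ : Rn n → ℝ) (u : Rn n → ℂ) (ρ : Zn n) : ℝ≥0∞ :=
  ∫⁻ k, ENNReal.ofReal (ψ k) * ∑' μ, ‖coef φ u ρ k μ‖ₑ ^ 2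

lemma lintegral_Tgen_sigmaFin_le (hΦ : IsCcInfty Φ) (h : IsDensity Φ K ψ) (hφ : IsCutoff φ D)
    (hΦφ : ∀ p, Φ p ≠ 0 → φ p.1 = 1 ∧ φ p.2 = 1) (hu : Continuous u) (hv : Continuous v)
    (hui : Integrable u) (hvi : Integrable v) (A : Zn n → Zn n → ℂ) (S : Finset (Zn n))
    (ρ : Zn n) :
    ∫⁻ y in cube n 1, ‖Tgen (sigmaFin A Φ S) u v (y + coeZ ρ)‖ₑ ^ 2 ≤
      (∫⁻ k, ENNReal.ofReal (ψ k)) ^ 2 * (normB A ^ 2 *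
        (coefEnergy ψ φ u ρ * coefEnergy ψ φ v ρ)) := by
  set w : Rn n → ℝ≥0∞ := fun k => ENNReal.ofReal (ψ k) with hw
  have hwm : Measurable w := h.continuous_weight.measurable.ennreal_ofReal
  set I : ℝ≥0∞ := ∫⁻ k, w k
  have hc := continuous_chi
  have hcu := hφ.continuous_coef hu hui ρ
  have hcv := hφ.continuous_coef hv hvi ρ
  set G : Rn n → Rn n × Rn n → ℂ := fun y κ => ∑ μ ∈ S, ∑ ν ∈ S,
    A μ ν * coef φ u ρ κ.1 μ * coef φ v ρ κ.2 ν * chi (coeZ (μ + ν) ⬝ᵥ y) with hG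
  have hGc : Continuous (Function.uncurry G) := by
    simp only [hG, Function.uncurry_def]
    refine continuous_finsetSum _ fun μ _ => continuous_finsetSum _ fun ν _ => ?_
    have h1 : Continuous fun x : Rn n × Rn n × Rn n => coef φ u ρ x.2.1 μ :=
      (hcu μ).comp (by fun_prop)
    have h2 : Continuous fun x : Rn n × Rn n × Rn n => coef φ v ρ x.2.2 ν :=
      (hcv ν).comp (by fun_prop)
    have h3 : Continuous fun x : Rn n × Rn n × Rn n => chi (coeZ (μ + ν) ⬝ᵥ x.1) :=
      hc.comp (by fun_prop)
    exact ((continuous_const.mul h1).mul h2).mul h3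
  have hGm : Measurable fun z : Rn n × Rn n × Rn n => ‖G z.1 z.2‖ₑ := hGc.enorm.measurable
  have hrep : ∀ y, Tgen (sigmaFin A Φ S) u v (y + coeZ ρ) =
      ∫ κ : Rn n × Rn n, K (κ.1 - y, κ.2 - y) * G y κ := by
    intro y
    rw [Tgen_sigmaFin hΦ hu hv hui hvi]
    simp_rw [Tgen_translate_eq h hφ hΦφ hu hv hui hvi, ← integral_const_mul]
    have hi : ∀ μ ν : Zn n, Integrable fun κ : Rn n × Rn n => A μ ν * (chi (coeZ (μ + ν) ⬝ᵥ y) *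
        (K (κ.1 - y, κ.2 - y) * (coef φ u ρ κ.1 μ * coef φ v ρ κ.2 ν))) := by
      intro μ ν
      refine Integrable.const_mul (Integrable.const_mul ?_ _) _
      refine (h.integrable_shift y).mul_bdd (c := (∫ ξ, ‖u ξ‖) * ∫ ξ, ‖v ξ‖) ?_
        (Filter.Eventually.of_forall fun κ => ?_)
      · exact (((hcu μ).comp continuous_fst).mul
          ((hcv ν).comp continuous_snd)).aestronglyMeasurable
      · rw [norm_mul]
        exact mul_le_mul (hφ.norm_coef_le hui _ _ _) (hφ.norm_coef_le hvi _ _ _)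
          (norm_nonneg _) (integral_nonneg fun _ => norm_nonneg _)
    rw [← Finset.sum_congr rfl fun μ _ => integral_finsetSum S fun ν _ => hi μ ν,
      ← integral_finsetSum S fun μ _ => integrable_finsetSum S fun ν _ => hi μ ν]
    refine integral_congr_ae (Filter.Eventually.of_forall fun κ => ?_)
    simp only [hG, Finset.mul_sum]
    refine Finset.sum_congr rfl fun μ _ => Finset.sum_congr rfl fun ν _ => ?_
    ring
  have hpt : ∀ y ∈ cube n 1, ‖Tgen (sigmaFin A Φ S) u v (y + coeZ ρ)‖ₑ ^ 2 ≤
      I ^ 2 * ∫⁻ κ : Rn n × Rn n, w κ.1 * w κ.2 * ‖G y κ‖ₑ ^ 2 := by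
    intro y hy
    have hGy : Measurable fun κ : Rn n × Rn n => ‖G y κ‖ₑ :=
      hGm.comp (g := fun z : Rn n × Rn n × Rn n => ‖G z.1 z.2‖ₑ) (f := fun κ => (y, κ))
        (by fun_prop)
    have h1 : ‖Tgen (sigmaFin A Φ S) u v (y + coeZ ρ)‖ₑ ≤
        ∫⁻ κ : Rn n × Rn n, w κ.1 * w κ.2 * 1 * ‖G y κ‖ₑ := by
      rw [hrep]
      refine (enorm_integral_le_lintegral_enorm _).trans (lintegral_mono fun κ => ?_)
      rw [enorm_mul, mul_one]
      gcongr
      exact h.enorm_le hy κ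
    calc _ ≤ _ := pow_le_pow_left₀ zero_le h1 2
      _ ≤ _ := lintegral_weight_mul_sq_le volume (w := fun κ : Rn n × Rn n => w κ.1 * w κ.2)
          (by fun_prop) aemeasurable_const hGy.aemeasurable
      _ = _ := by
          simp only [one_pow, mul_one]
          rw [lintegral_prod_mul_self w hwm]
  calc ∫⁻ y in cube n 1, ‖Tgen (sigmaFin A Φ S) u v (y + coeZ ρ)‖ₑ ^ 2
      ≤ ∫⁻ y in cube n 1, I ^ 2 * ∫⁻ κ : Rn n × Rn n, w κ.1 * w κ.2 * ‖G y κ‖ₑ ^ 2 :=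
        setLIntegral_mono' (measurableSet_cube 1) hpt
    _ = I ^ 2 * ∫⁻ κ : Rn n × Rn n, w κ.1 * w κ.2 * ∫⁻ y in cube n 1, ‖G y κ‖ₑ ^ 2 := by
        have hm : Measurable (Function.uncurry fun (y : Rn n) (κ : Rn n × Rn n) =>
            w κ.1 * w κ.2 * ‖G y κ‖ₑ ^ 2) := by
          unfold Function.uncurry
          fun_prop
        have hm' : Measurable fun y : Rn n =>
            ∫⁻ κ : Rn n × Rn n, w κ.1 * w κ.2 * ‖G y κ‖ₑ ^ 2 := hm.lintegral_prod_right'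
        rw [lintegral_const_mul _ hm', lintegral_lintegral_swap hm.aemeasurable]
        congr 1
        refine lintegral_congr fun κ => ?_
        rw [lintegral_const_mul]
        exact (hGm.comp (g := fun z : Rn n × Rn n × Rn n => ‖G z.1 z.2‖ₑ) (f := fun y => (y, κ))
          (by fun_prop)).pow_const 2
    _ ≤ I ^ 2 * ∫⁻ κ : Rn n × Rn n, w κ.1 * w κ.2 * (normB A ^ 2 *
          (∑' μ, ‖coef φ u ρ κ.1 μ‖ₑ ^ 2) * ∑' ν, ‖coef φ v ρ κ.2 ν‖ₑ ^ 2) := by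
        gcongr with κ
        refine (lintegral_bilinear_trig_le A S _ _).trans ?_
        gcongr
        · exact ENNReal.sum_le_tsum _
        · exact ENNReal.sum_le_tsum _
    _ = _ := by
        have hmu : ∀ {f : Zn n → Rn n → ℂ}, (∀ μ, Continuous (f μ)) →
            Measurable fun k => w k * ∑' μ, ‖f μ k‖ₑ ^ 2 := fun hf =>
          hwm.mul (Measurable.tsum fun μ => (hf μ).enorm.measurable.pow_const 2)
        congr 1
        rw [coefEnergy, coefEnergy, ← lintegral_prod_mul (hmu hcu).aemeasurable
          (hmu hcv).aemeasurable, ← lintegral_const_mul, Measure.volume_eq_prod]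
        · refine lintegral_congr fun κ => ?_
          ring
        · exact ((hmu hcu).comp measurable_fst).mul ((hmu hcv).comp measurable_snd)

end Truncation

section UpperBound

variable {n : ℕ} {Φ K : Rn n × Rn n → ℂ} {ψ φ : Rn n → ℝ} {D : ℝ≥0} {u v : Rn n → ℂ}

lemma continuous_Tgen {σ : Rn n × Rn n → ℂ} {M : ℝ} (hσ : AEStronglyMeasurable σ)
    (hM : ∀ p, ‖σ p‖ ≤ M) (hui : Integrable u) (hvi : Integrable v) : Continuous (Tgen σ u v) := by
  have hc := continuous_chi
  refine continuous_of_dominated (bound := fun p : Rn n × Rn n => M * (‖u p.1‖ * ‖v p.2‖))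
    (fun x => ?_) (fun x => Filter.Eventually.of_forall fun p => ?_)
    ((hui.norm.mul_prod hvi.norm).const_mul M) (Filter.Eventually.of_forall fun p => by fun_prop)
  · have h1 : Continuous fun p : Rn n × Rn n => chi (x ⬝ᵥ (p.1 + p.2)) := by fun_prop
    exact ((h1.aestronglyMeasurable.mul hσ).mul hui.aestronglyMeasurable.comp_fst).mul
      hvi.aestronglyMeasurable.comp_snd
  · rw [norm_mul, norm_mul, norm_mul, norm_chi, one_mul, mul_assoc]
    gcongr
    exact hM p

lemma exists_sum_norm_le (hΦ : IsCcInfty Φ) (hφ : IsCutoff φ D)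
    (hΦφ : ∀ p, Φ p ≠ 0 → φ p.1 = 1 ∧ φ p.2 = 1) {A : Zn n → Zn n → ℂ} (hA : IsLinftyMatrix A) :
    ∃ M : ℝ, ∀ (p : Rn n × Rn n) (s : Finset (Zn n × Zn n)),
      ∑ μν ∈ s, ‖A μν.1 μν.2 * Φ (p.1 - coeZ μν.1, p.2 - coeZ μν.2)‖ ≤ M := by
  obtain ⟨B, hB⟩ := hA
  obtain ⟨C, hC⟩ := hΦ.2.exists_bound_of_continuous hΦ.1.continuous
  have hB0 : 0 ≤ B := (norm_nonneg _).trans (hB 0 0)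
  have hC0 : 0 ≤ C := (norm_nonneg _).trans (hC 0)
  refine ⟨B * C * (D * D), fun p s => ?_⟩
  rw [← ENNReal.ofReal_le_ofReal_iff (by positivity),
    ENNReal.ofReal_sum_of_nonneg fun _ _ => norm_nonneg _]
  have hpt : ∀ q : Rn n × Rn n, ‖Φ q‖ ≤ C * (φ q.1 * φ q.2) := by
    intro q
    by_cases h0 : Φ q = 0
    · rw [h0, norm_zero]
      exact mul_nonneg hC0 (mul_nonneg (hφ.nonneg _) (hφ.nonneg _))
    · have := hΦφ q h0
      rw [this.1, this.2, mul_one, mul_one]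
      exact hC q
  calc ∑ μν ∈ s, ENNReal.ofReal ‖A μν.1 μν.2 * Φ (p.1 - coeZ μν.1, p.2 - coeZ μν.2)‖
      ≤ ∑ μν ∈ s, ENNReal.ofReal (B * C) * (ENNReal.ofReal (φ (p.1 - coeZ μν.1)) *
          ENNReal.ofReal (φ (p.2 - coeZ μν.2))) := by
        refine Finset.sum_le_sum fun μν _ => ?_
        rw [← ENNReal.ofReal_mul (hφ.nonneg _), ← ENNReal.ofReal_mul (by positivity)]
        refine ENNReal.ofReal_le_ofReal ?_
        rw [norm_mul, mul_assoc]
        exact mul_le_mul (hB _ _) (hpt _) (norm_nonneg _) hB0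
    _ ≤ ∑' μν : Zn n × Zn n, ENNReal.ofReal (B * C) * (ENNReal.ofReal (φ (p.1 - coeZ μν.1)) *
          ENNReal.ofReal (φ (p.2 - coeZ μν.2))) := ENNReal.sum_le_tsum _
    _ = ENNReal.ofReal (B * C) * ((∑' μ : Zn n, ENNReal.ofReal (φ (p.1 - coeZ μ))) *
          ∑' ν : Zn n, ENNReal.ofReal (φ (p.2 - coeZ ν))) := by
        rw [ENNReal.tsum_mul_left, ENNReal.tsum_prod (f := fun μ ν : Zn n =>
          ENNReal.ofReal (φ (p.1 - coeZ μ)) * ENNReal.ofReal (φ (p.2 - coeZ ν)))]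
        simp_rw [ENNReal.tsum_mul_left, ENNReal.tsum_mul_right]
    _ ≤ ENNReal.ofReal (B * C) * (D * D) := by
        gcongr
        · exact hφ.tsum_le _
        · exact hφ.tsum_le _
    _ = ENNReal.ofReal (B * C * (D * D)) := by
        rw [ENNReal.ofReal_mul (p := B * C) (by positivity), ← NNReal.coe_mul,
          ENNReal.ofReal_coe_nnreal, ENNReal.coe_mul]

lemma sigmaFin_eq_sum (A : Zn n → Zn n → ℂ) (S : Finset (Zn n)) (p : Rn n × Rn n) :
    sigmaFin A Φ S p = ∑ μν ∈ S ×ˢ S, A μν.1 μν.2 * Φ (p.1 - coeZ μν.1, p.2 - coeZ μν.2) := by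
  rw [Finset.sum_product, sigmaFin]

lemma exists_norm_sigmaFin_le (hΦ : IsCcInfty Φ) (hφ : IsCutoff φ D)
    (hΦφ : ∀ p, Φ p ≠ 0 → φ p.1 = 1 ∧ φ p.2 = 1) {A : Zn n → Zn n → ℂ} (hA : IsLinftyMatrix A) :
    ∃ M : ℝ, ∀ S p, ‖sigmaFin A Φ S p‖ ≤ M := by
  obtain ⟨M, hM⟩ := exists_sum_norm_le hΦ hφ hΦφ hA
  refine ⟨M, fun S p => ?_⟩
  rw [sigmaFin_eq_sum]
  exact (norm_sum_le _ _).trans (hM p _)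

lemma summable_sigmaA (hΦ : IsCcInfty Φ) (hφ : IsCutoff φ D)
    (hΦφ : ∀ p, Φ p ≠ 0 → φ p.1 = 1 ∧ φ p.2 = 1) {A : Zn n → Zn n → ℂ} (hA : IsLinftyMatrix A)
    (p : Rn n × Rn n) :
    Summable fun μν : Zn n × Zn n => A μν.1 μν.2 * Φ (p.1 - coeZ μν.1, p.2 - coeZ μν.2) := by
  obtain ⟨M, hM⟩ := exists_sum_norm_le hΦ hφ hΦφ hA
  exact Summable.of_norm (summable_of_sum_le (fun _ => norm_nonneg _) (hM p))

lemma tendsto_sigmaFin (hΦ : IsCcInfty Φ) (hφ : IsCutoff φ D)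
    (hΦφ : ∀ p, Φ p ≠ 0 → φ p.1 = 1 ∧ φ p.2 = 1) {A : Zn n → Zn n → ℂ} (hA : IsLinftyMatrix A)
    (p : Rn n × Rn n) :
    Filter.Tendsto (fun S => sigmaFin A Φ S p) Filter.atTop (nhds (sigmaA A Φ p)) := by
  simp_rw [sigmaFin_eq_sum]
  have hd : Filter.Tendsto (fun S : Finset (Zn n) => S ×ˢ S) Filter.atTop Filter.atTop :=
    Filter.tendsto_finsetProd_atTop.comp Filter.tendsto_atTop_diagonal
  exact (summable_sigmaA hΦ hφ hΦφ hA p).hasSum.comp hd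

lemma continuous_sigmaFin (hΦ : IsCcInfty Φ) (A : Zn n → Zn n → ℂ) (S : Finset (Zn n)) :
    Continuous (sigmaFin A Φ S) := by
  have := hΦ.1.continuous
  unfold sigmaFin
  fun_prop

lemma exists_norm_sigmaA_le (hΦ : IsCcInfty Φ) (hφ : IsCutoff φ D)
    (hΦφ : ∀ p, Φ p ≠ 0 → φ p.1 = 1 ∧ φ p.2 = 1) {A : Zn n → Zn n → ℂ} (hA : IsLinftyMatrix A) :
    ∃ M : ℝ, ∀ p, ‖sigmaA A Φ p‖ ≤ M := by
  obtain ⟨M, hM⟩ := exists_norm_sigmaFin_le hΦ hφ hΦφ hA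
  exact ⟨M, fun p => le_of_tendsto (tendsto_sigmaFin hΦ hφ hΦφ hA p).norm
    (Filter.Eventually.of_forall fun S => hM S p)⟩

lemma stronglyMeasurable_sigmaA (hΦ : IsCcInfty Φ) (hφ : IsCutoff φ D)
    (hΦφ : ∀ p, Φ p ≠ 0 → φ p.1 = 1 ∧ φ p.2 = 1) {A : Zn n → Zn n → ℂ} (hA : IsLinftyMatrix A) :
    StronglyMeasurable (sigmaA A Φ) :=
  stronglyMeasurable_of_tendsto Filter.atTop
    (fun S => (continuous_sigmaFin hΦ A S).stronglyMeasurable)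
    (tendsto_pi_nhds.2 (tendsto_sigmaFin hΦ hφ hΦφ hA))

lemma tendsto_Tgen_sigmaFin (hΦ : IsCcInfty Φ) (hφ : IsCutoff φ D)
    (hΦφ : ∀ p, Φ p ≠ 0 → φ p.1 = 1 ∧ φ p.2 = 1) {A : Zn n → Zn n → ℂ} (hA : IsLinftyMatrix A)
    (hui : Integrable u) (hvi : Integrable v) (x : Rn n) :
    Filter.Tendsto (fun S => Tgen (sigmaFin A Φ S) u v x) Filter.atTop
      (nhds (Tgen (sigmaA A Φ) u v x)) := by
  obtain ⟨M, hM⟩ := exists_norm_sigmaFin_le hΦ hφ hΦφ hA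
  have hc := continuous_chi
  refine tendsto_integral_filter_of_dominated_convergence
    (fun p : Rn n × Rn n => M * (‖u p.1‖ * ‖v p.2‖)) (Filter.Eventually.of_forall fun S => ?_)
    (Filter.Eventually.of_forall fun S => Filter.Eventually.of_forall fun p => ?_)
    ((hui.norm.mul_prod hvi.norm).const_mul M) (Filter.Eventually.of_forall fun p => ?_)
  · have h1 : Continuous fun p : Rn n × Rn n => chi (x ⬝ᵥ (p.1 + p.2)) := by fun_prop
    exact ((h1.mul (continuous_sigmaFin hΦ A S)).aestronglyMeasurable.mul
      hui.aestronglyMeasurable.comp_fst).mul hvi.aestronglyMeasurable.comp_snd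
  · rw [norm_mul, norm_mul, norm_mul, norm_chi, one_mul, mul_assoc]
    gcongr
    exact hM S p
  · exact (((tendsto_sigmaFin hΦ hφ hΦφ hA p).const_mul _).mul_const _).mul_const _

lemma lintegral_Tgen_sigmaA_le (hΦ : IsCcInfty Φ) (h : IsDensity Φ K ψ) (hφ : IsCutoff φ D)
    (hΦφ : ∀ p, Φ p ≠ 0 → φ p.1 = 1 ∧ φ p.2 = 1) {A : Zn n → Zn n → ℂ} (hA : IsLinftyMatrix A)
    (hu : Continuous u) (hv : Continuous v) (hui : Integrable u) (hvi : Integrable v) (ρ : Zn n) :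
    ∫⁻ y in cube n 1, ‖Tgen (sigmaA A Φ) u v (y + coeZ ρ)‖ₑ ^ 2 ≤
      (∫⁻ k, ENNReal.ofReal (ψ k)) ^ 2 * (normB A ^ 2 *
        (coefEnergy ψ φ u ρ * coefEnergy ψ φ v ρ)) := by
  obtain ⟨M, hM⟩ := exists_norm_sigmaFin_le hΦ hφ hΦφ hA
  have hmeas : ∀ S, Measurable fun y => ‖Tgen (sigmaFin A Φ S) u v (y + coeZ ρ)‖ₑ ^ 2 := by
    intro S
    have := continuous_Tgen (continuous_sigmaFin hΦ A S).aestronglyMeasurable (hM S) hui hvi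
    exact (this.comp (continuous_add_const _)).enorm.measurable.pow_const 2
  calc ∫⁻ y in cube n 1, ‖Tgen (sigmaA A Φ) u v (y + coeZ ρ)‖ₑ ^ 2
      = ∫⁻ y in cube n 1, Filter.liminf
          (fun S => ‖Tgen (sigmaFin A Φ S) u v (y + coeZ ρ)‖ₑ ^ 2) Filter.atTop := by
        refine lintegral_congr fun y => ?_
        exact (((ENNReal.continuous_pow 2).tendsto _).comp
          (tendsto_Tgen_sigmaFin hΦ hφ hΦφ hA hui hvi (y + coeZ ρ)).enorm).liminf_eq.symm
    _ ≤ Filter.liminf (fun S => ∫⁻ y in cube n 1,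
          ‖Tgen (sigmaFin A Φ S) u v (y + coeZ ρ)‖ₑ ^ 2) Filter.atTop := lintegral_liminf_le hmeas
    _ ≤ Filter.liminf (fun _ : Finset (Zn n) => (∫⁻ k, ENNReal.ofReal (ψ k)) ^ 2 * (normB A ^ 2 *
        (coefEnergy ψ φ u ρ * coefEnergy ψ φ v ρ))) Filter.atTop :=
        Filter.liminf_le_liminf (Filter.Eventually.of_forall fun S =>
          lintegral_Tgen_sigmaFin_le hΦ h hφ hΦφ hu hv hui hvi A S ρ)
    _ = _ := Filter.liminf_const _

lemma tsum_coefEnergy_le (hψ : Continuous ψ) (hφ : IsCutoff φ D) (hu : Continuous u)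
    (hui : Integrable u) :
    ∑' ρ, coefEnergy ψ φ u ρ ≤
      (∫⁻ k, ENNReal.ofReal (ψ k)) * ((D : ℝ≥0∞) ^ 2 * ∫⁻ ξ, ‖u ξ‖ₑ ^ 2) := by
  have hwm : Measurable fun k => ENNReal.ofReal (ψ k) := hψ.measurable.ennreal_ofReal
  simp only [coefEnergy]
  have hm : ∀ ρ, AEMeasurable (fun k => ENNReal.ofReal (ψ k) * ∑' μ, ‖coef φ u ρ k μ‖ₑ ^ 2) :=
    fun ρ => (hwm.mul (Measurable.tsum fun μ =>
      (hφ.continuous_coef hu hui ρ μ).enorm.measurable.pow_const 2)).aemeasurable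
  rw [← lintegral_tsum hm, ← lintegral_mul_const _ hwm]
  refine lintegral_mono fun k => ?_
  simp only
  rw [ENNReal.tsum_mul_left]
  gcongr
  exact hφ.tsum_coef_sq_le hu hui k

lemma rpow_half_sq (x : ℝ≥0∞) : (x ^ (1 / 2 : ℝ)) ^ 2 = x := by
  rw [← ENNReal.rpow_natCast, ← ENNReal.rpow_mul]
  norm_num

lemma sq_rpow_half (x : ℝ≥0∞) : (x ^ 2) ^ (1 / 2 : ℝ) = x := by
  rw [← ENNReal.rpow_natCast, ← ENNReal.rpow_mul]
  norm_num

lemma tsum_sqrt_mul_sq_le (a b : Zn n → ℝ≥0∞) :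
    (∑' ρ, (a ρ * b ρ) ^ (1 / 2 : ℝ)) ^ 2 ≤ (∑' ρ, a ρ) * ∑' ρ, b ρ := by
  have h := lintegral_weight_mul_sq_le (Measure.count : Measure (Zn n)) (w := fun _ => 1)
    (f := fun ρ => a ρ ^ (1 / 2 : ℝ)) (g := fun ρ => b ρ ^ (1 / 2 : ℝ))
    (Measurable.of_discrete).aemeasurable (Measurable.of_discrete).aemeasurable
    (Measurable.of_discrete).aemeasurable
  simp only [lintegral_count, one_mul, rpow_half_sq] at h
  simpa only [ENNReal.mul_rpow_of_nonneg _ _ (by norm_num : (0 : ℝ) ≤ 1 / 2)] using h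

lemma lintegral_enorm_sq_eq_one {f : 𝓢(Rn n, ℂ)} (hf : eLpNorm (⇑f) 2 volume = 1) :
    ∫⁻ x, ‖f x‖ₑ ^ 2 = 1 := by
  have h2 := eLpNorm_nnreal_pow_eq_lintegral (f := (⇑f)) (μ := volume) (p := 2) (by norm_num)
  have e : ((2 : ℝ≥0) : ℝ≥0∞) = 2 := rfl
  rw [e, hf] at h2
  simpa using h2.symm

lemma multNorm_le (hΦ : IsCcInfty Φ) (h : IsDensity Φ K ψ) (hφ : IsCutoff φ D)
    (hΦφ : ∀ p, Φ p ≠ 0 → φ p.1 = 1 ∧ φ p.2 = 1) {A : Zn n → Zn n → ℂ} (hA : IsLinftyMatrix A)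
    {q : ℝ≥0∞} (hq : 1 ≤ q) :
    multNorm q (sigmaA A Φ) ≤
      ((∫⁻ k, ENNReal.ofReal (ψ k)) ^ 2 * (D : ℝ≥0∞) ^ 2) * normB A := by
  refine iSup_le fun f => iSup_le fun g => iSup_le fun hf => iSup_le fun hg => ?_
  have hf1 := (lintegral_ft_sq f).trans (lintegral_enorm_sq_eq_one hf)
  have hg1 := (lintegral_ft_sq g).trans (lintegral_enorm_sq_eq_one hg)
  set I : ℝ≥0∞ := ∫⁻ k, ENNReal.ofReal (ψ k)
  have ha := tsum_coefEnergy_le h.continuous_weight hφ (ft_continuous f) (ft_integrable f)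
  have hb := tsum_coefEnergy_le h.continuous_weight hφ (ft_continuous g) (ft_integrable g)
  rw [hf1, mul_one] at ha
  rw [hg1, mul_one] at hb
  have hloc : ∀ ρ, localL2 (Tbil (sigmaA A Φ) f g) ρ ≤ I * normB A *
      (coefEnergy ψ φ (ft f) ρ * coefEnergy ψ φ (ft g) ρ) ^ (1 / 2 : ℝ) := by
    intro ρ
    have h1 := lintegral_Tgen_sigmaA_le hΦ h hφ hΦφ hA (ft_continuous f) (ft_continuous g)
      (ft_integrable f) (ft_integrable g) ρ
    calc localL2 (Tbil (sigmaA A Φ) f g) ρ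
        ≤ (I ^ 2 * (normB A ^ 2 *
          (coefEnergy ψ φ (ft f) ρ * coefEnergy ψ φ (ft g) ρ))) ^ (1 / 2 : ℝ) :=
          ENNReal.rpow_le_rpow h1 (by norm_num)
      _ = _ := by
          rw [← mul_assoc, ← mul_pow, ENNReal.mul_rpow_of_nonneg _ _ (by norm_num), sq_rpow_half]
  calc amalgamNorm q (Tbil (sigmaA A Φ) f g)
      ≤ ∑' ρ, localL2 (Tbil (sigmaA A Φ) f g) ρ := amalgamNorm_le_tsum q hq _
    _ ≤ ∑' ρ, I * normB A *
          (coefEnergy ψ φ (ft f) ρ * coefEnergy ψ φ (ft g) ρ) ^ (1 / 2 : ℝ) :=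
        ENNReal.tsum_le_tsum hloc
    _ = I * normB A * ∑' ρ, (coefEnergy ψ φ (ft f) ρ * coefEnergy ψ φ (ft g) ρ) ^ (1 / 2 : ℝ) :=
        ENNReal.tsum_mul_left
    _ ≤ I * normB A * (I * (D : ℝ≥0∞) ^ 2) := by
        gcongr
        rw [← ENNReal.pow_le_pow_left_iff two_ne_zero]
        refine (tsum_sqrt_mul_sq_le _ _).trans ?_
        rw [sq (I * (D : ℝ≥0∞) ^ 2)]
        exact mul_le_mul' ha hb
    _ = _ := by ring

end UpperBound

section Homogeneity

variable {n : ℕ}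

lemma ft_smul (c : ℂ) (f : 𝓢(Rn n, ℂ)) (ξ : Rn n) : ft (c • f) ξ = c * ft f ξ := by
  rw [ft, ft, ← integral_const_mul]
  refine integral_congr_ae (Filter.Eventually.of_forall fun x => ?_)
  simp only [smul_apply, smul_eq_mul]
  ring

lemma Tbil_smul_smul (σ : Rn n × Rn n → ℂ) (a b : ℂ) (f g : 𝓢(Rn n, ℂ)) (x : Rn n) :
    Tbil σ (a • f) (b • g) x = (a * b) * Tbil σ f g x := by
  simp only [Tbil_eq_Tgen, Tgen, ft_smul]
  rw [← integral_const_mul]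
  refine integral_congr_ae (Filter.Eventually.of_forall fun x => ?_)
  ring

lemma localL2_const_mul (c : ℂ) (h : Rn n → ℂ) (ν : Zn n) :
    localL2 (fun x => c * h x) ν = ‖c‖ₑ * localL2 h ν := by
  have e : ∀ x : Rn n, (‖c * h (x + coeZ ν)‖₊ : ℝ≥0∞) ^ 2 =
      ‖c‖ₑ ^ 2 * (‖h (x + coeZ ν)‖₊ : ℝ≥0∞) ^ 2 := by
    intro x
    rw [nnnorm_mul, ENNReal.coe_mul, mul_pow]
    rfl
  simp only [localL2, e]
  rw [lintegral_const_mul' _ _ (ENNReal.pow_ne_top enorm_ne_top),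
    ENNReal.mul_rpow_of_nonneg _ _ (by norm_num), sq_rpow_half]

lemma exists_normalized {f : 𝓢(Rn n, ℂ)} (hf : f ≠ 0) :
    ∃ (c : ℂ) (f' : 𝓢(Rn n, ℂ)), f = c • f' ∧ eLpNorm (⇑f') 2 volume = 1 ∧
      ‖c‖ₑ = eLpNorm (⇑f) 2 volume := by
  have htop : eLpNorm (⇑f) 2 volume ≠ ∞ := (f.memLp 2 volume).eLpNorm_ne_top
  have h0 : eLpNorm (⇑f) 2 volume ≠ 0 := by
    intro h
    rw [eLpNorm_eq_zero_iff f.continuous.aestronglyMeasurable two_ne_zero,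
      f.continuous.ae_eq_iff_eq _ continuous_zero] at h
    exact hf (DFunLike.ext _ _ fun x => congrFun h x)
  set c : ℂ := ((eLpNorm (⇑f) 2 volume).toReal : ℂ) with hc
  have hcn : ‖c‖ₑ = eLpNorm (⇑f) 2 volume := by
    rw [hc, ← ofReal_norm, Complex.norm_real, Real.norm_of_nonneg ENNReal.toReal_nonneg,
      ENNReal.ofReal_toReal htop]
  have hc0 : c ≠ 0 := by
    intro h
    rw [h, enorm_zero] at hcn
    exact h0 hcn.symm
  refine ⟨c, c⁻¹ • f, by rw [smul_inv_smul₀ hc0], ?_, hcn⟩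
  have e : (⇑(c⁻¹ • f) : Rn n → ℂ) = c⁻¹ • ⇑f := rfl
  rw [e, eLpNorm_const_smul, enorm_inv hc0, hcn, ENNReal.inv_mul_cancel h0 htop]

lemma localL2_Tbil_le {q : ℝ≥0∞} (hq : 1 ≤ q) (σ : Rn n × Rn n → ℂ) (f g : 𝓢(Rn n, ℂ)) :
    localL2 (Tbil σ f g) 0 ≤
      multNorm q σ * (eLpNorm (⇑f) 2 volume * eLpNorm (⇑g) 2 volume) := by
  have hzero : localL2 (fun _ : Rn n => (0 : ℂ)) 0 = 0 := by
    simp [localL2]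
  by_cases hf : f = 0
  · have : Tbil σ f g = fun _ => 0 := by
      ext x
      simp [hf, Tbil, ft]
    rw [this, hzero]
    exact zero_le
  by_cases hg : g = 0
  · have : Tbil σ f g = fun _ => 0 := by
      ext x
      simp [hg, Tbil, ft]
    rw [this, hzero]
    exact zero_le
  obtain ⟨a, f', hfa, hf', ha⟩ := exists_normalized hf
  obtain ⟨b, g', hgb, hg', hb⟩ := exists_normalized hg
  have hT : Tbil σ f g = fun x => (a * b) * Tbil σ f' g' x := by
    ext x
    rw [hfa, hgb, Tbil_smul_smul]
  rw [hT, localL2_const_mul, enorm_mul, ha, hb, mul_comm]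
  gcongr
  calc localL2 (Tbil σ f' g') 0 ≤ amalgamNorm q (Tbil σ f' g') := amalgamNorm_top_le q hq _ 0
    _ ≤ multNorm q σ :=
      le_iSup_of_le f' (le_iSup_of_le g' (le_iSup_of_le hf' (le_iSup_of_le hg' le_rfl)))

lemma eLpNorm_two_sq (f : Rn n → ℂ) : eLpNorm f 2 volume ^ 2 = ∫⁻ x, ‖f x‖ₑ ^ 2 := by
  have h2 := eLpNorm_nnreal_pow_eq_lintegral (f := f) (μ := volume) (p := 2) (by norm_num)
  have e : ((2 : ℝ≥0) : ℝ≥0∞) = 2 := rfl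
  rw [e] at h2
  simpa using h2

lemma lintegral_Tgen_le {q : ℝ≥0∞} (hq : 1 ≤ q) (σ : Rn n × Rn n → ℂ) {u v : Rn n → ℂ}
    (hu : IsCcInfty u) (hv : IsCcInfty v) :
    ∫⁻ y in cube n 1, ‖Tgen σ u v y‖ₑ ^ 2 ≤
      multNorm q σ ^ 2 * ((∫⁻ ξ, ‖u ξ‖ₑ ^ 2) * ∫⁻ ξ, ‖v ξ‖ₑ ^ 2) := by
  obtain ⟨f, rfl⟩ := exists_ft_eq hu
  obtain ⟨g, rfl⟩ := exists_ft_eq hv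
  rw [lintegral_ft_sq, lintegral_ft_sq, ← eLpNorm_two_sq, ← eLpNorm_two_sq, ← mul_pow, ← mul_pow]
  have h := pow_le_pow_left₀ zero_le (localL2_Tbil_le hq σ f g) 2
  rw [localL2, rpow_half_sq] at h
  simp only [coeZ_zero, add_zero] at h
  exact h

end Homogeneity

section WavePackets

variable {n : ℕ} {Θ Φ K : Rn n × Rn n → ℂ} {ψ φ : Rn n → ℝ} {D : ℝ≥0}

lemma contDiff_chi : ContDiff ℝ (⊤ : ℕ∞) chi :=
  (contDiff_const.mul Complex.ofRealCLM.contDiff).cexp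

/-- Superposition of modulated lattice translates of a cutoff. -/
noncomputable def packet (φ : Rn n → ℝ) (F : Zn n →₀ ℂ) (k ξ : Rn n) : ℂ :=
  ∑ μ ∈ F.support, F μ * (chi (k ⬝ᵥ (ξ - coeZ μ)) * φ (ξ - coeZ μ))

lemma IsCutoff.isCcInfty_packet (hφ : IsCutoff φ D) (F : Zn n →₀ ℂ) (k : Rn n) :
    IsCcInfty (packet φ F k) := by
  constructor
  · refine ContDiff.sum fun μ _ => contDiff_const.mul (ContDiff.mul ?_ ?_)
    · refine contDiff_chi.comp ?_
      unfold dotProduct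
      fun_prop
    · exact Complex.ofRealCLM.contDiff.comp
        (hφ.contDiff.comp (contDiff_id.sub contDiff_const))
  · unfold packet
    classical
    induction F.support using Finset.induction_on with
    | empty => exact HasCompactSupport.zero
    | insert μ S hμ ih =>
      simp_rw [Finset.sum_insert hμ]
      refine HasCompactSupport.add ?_ ih
      have h1 : HasCompactSupport fun ξ : Rn n => φ (ξ - coeZ μ) :=
        hφ.compact.comp_homeomorph (Homeomorph.subRight (coeZ μ))
      refine h1.mono fun ξ hξ => ?_
      rw [Function.mem_support] at hξ ⊢
      contrapose! hξ
      simp [hξ]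

/-- The envelope of `packet`. -/
noncomputable def envelope (φ : Rn n → ℝ) (F : Zn n →₀ ℂ) (ξ : Rn n) : ℝ :=
  ∑ μ ∈ F.support, ‖F μ‖ * φ (ξ - coeZ μ)

lemma IsCutoff.norm_packet_le (hφ : IsCutoff φ D) (F : Zn n →₀ ℂ) (k ξ : Rn n) :
    ‖packet φ F k ξ‖ ≤ envelope φ F ξ := by
  refine (norm_sum_le _ _).trans (Finset.sum_le_sum fun μ _ => ?_)
  rw [norm_mul, norm_mul, norm_chi, one_mul, Complex.norm_real, Real.norm_of_nonneg (hφ.nonneg _)]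

lemma IsCutoff.integrable (hφ : IsCutoff φ D) : Integrable φ :=
  hφ.continuous.integrable_of_hasCompactSupport hφ.compact

lemma IsCutoff.integrable_envelope (hφ : IsCutoff φ D) (F : Zn n →₀ ℂ) :
    Integrable (envelope φ F) :=
  integrable_finsetSum _ fun μ _ => (hφ.integrable.comp_sub_right (coeZ μ)).const_mul _

lemma IsCutoff.continuous_packet (hφ : IsCutoff φ D) (F : Zn n →₀ ℂ) :
    Continuous (Function.uncurry (packet φ F)) := by
  have h1 := hφ.continuous
  have h2 := continuous_chi
  unfold Function.uncurry packet
  fun_prop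

lemma IsCutoff.lintegral_le (hφ : IsCutoff φ D) : ∫⁻ ξ, ENNReal.ofReal (φ ξ) ≤ D := by
  have hm := hφ.continuous.measurable
  refine (lintegral_le_tsum_cube _).trans ?_
  rw [← lintegral_tsum fun τ => by fun_prop]
  calc _ ≤ ∫⁻ _ in cube n 1, (D : ℝ≥0∞) := lintegral_mono fun y => hφ.tsum_add_le y
    _ = _ := by simp [volume_cube_one]

lemma IsCutoff.lintegral_packet_le (hφ : IsCutoff φ D) (F : Zn n →₀ ℂ) (k : Rn n) :
    ∫⁻ ξ, ‖packet φ F k ξ‖ₑ ^ 2 ≤ (D : ℝ≥0∞) ^ 2 * ∑ μ ∈ F.support, ‖F μ‖ₑ ^ 2 := by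
  have hm := hφ.continuous.measurable
  have hpt : ∀ ξ, ‖packet φ F k ξ‖ₑ ^ 2 ≤
      D * ∑ μ ∈ F.support, ENNReal.ofReal (φ (ξ - coeZ μ)) * ‖F μ‖ₑ ^ 2 := by
    intro ξ
    have h1 : ‖packet φ F k ξ‖ₑ ≤ ∑' μ, ENNReal.ofReal (φ (ξ - coeZ μ)) * 1 * ‖F μ‖ₑ := by
      refine (enorm_sum_le _ _).trans (le_trans (Finset.sum_le_sum fun μ _ => ?_)
        (ENNReal.sum_le_tsum F.support))
      rw [enorm_mul, enorm_mul, hφ.enorm_eq, ← ofReal_norm (chi _), norm_chi]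
      simp [mul_comm]
    have h2 := lintegral_weight_mul_sq_le (Measure.count : Measure (Zn n))
      (w := fun μ => ENNReal.ofReal (φ (ξ - coeZ μ))) (f := fun _ => 1) (g := fun μ => ‖F μ‖ₑ)
      (Measurable.of_discrete).aemeasurable (Measurable.of_discrete).aemeasurable
      (Measurable.of_discrete).aemeasurable
    simp only [lintegral_count] at h2
    refine (pow_le_pow_left₀ zero_le h1 2).trans (h2.trans ?_)
    gcongr
    · simpa using hφ.tsum_le ξ
    · refine (tsum_eq_sum fun μ hμ => ?_).le
      simp [Finsupp.notMem_support_iff.1 hμ]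
  calc ∫⁻ ξ, ‖packet φ F k ξ‖ₑ ^ 2
      ≤ ∫⁻ ξ, D * ∑ μ ∈ F.support, ENNReal.ofReal (φ (ξ - coeZ μ)) * ‖F μ‖ₑ ^ 2 :=
        lintegral_mono hpt
    _ = D * ∑ μ ∈ F.support, (∫⁻ ξ, ENNReal.ofReal (φ ξ)) * ‖F μ‖ₑ ^ 2 := by
        rw [lintegral_const_mul _ (by fun_prop), lintegral_finsetSum _ fun μ _ => by fun_prop]
        congr 1
        refine Finset.sum_congr rfl fun μ _ => ?_
        rw [lintegral_mul_const _ (by fun_prop),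
          lintegral_sub_right_eq_self (fun ξ => ENNReal.ofReal (φ ξ))]
    _ ≤ D * ∑ μ ∈ F.support, D * ‖F μ‖ₑ ^ 2 := by
        gcongr
        exact hφ.lintegral_le
    _ = _ := by rw [← Finset.mul_sum, sq, mul_assoc]

end WavePackets

section Recovery

variable {n : ℕ} {Θ Φ K : Rn n × Rn n → ℂ} {ψ φ : Rn n → ℝ} {D : ℝ≥0}

lemma integral_translate_mul_translate
    (hA2 : ∀ α β : Zn n, (∫ p : Rn n × Rn n, Θ p * Φ (p.1 - coeZ α, p.2 - coeZ β)) =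
      if α = 0 ∧ β = 0 then 1 else 0) (μ ν α β : Zn n) :
    ∫ p : Rn n × Rn n, Θ (p.1 - coeZ μ, p.2 - coeZ ν) * Φ (p.1 - coeZ α, p.2 - coeZ β) =
      if α = μ ∧ β = ν then 1 else 0 := by
  have h := hA2 (α - μ) (β - ν)
  simp only [sub_eq_zero] at h
  rw [← h, ← integral_sub_right_eq_self (fun p : Rn n × Rn n => Θ p *
    Φ (p.1 - coeZ (α - μ), p.2 - coeZ (β - ν))) (coeZ μ, coeZ ν)]
  refine integral_congr_ae (Filter.Eventually.of_forall fun p => ?_)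
  simp only [coeZ_sub, Prod.fst_sub, Prod.snd_sub, sub_sub_sub_cancel_right]
  rfl

lemma IsCcInfty.integrable_shift (hΘ : IsCcInfty Θ) (μ ν : Zn n) :
    Integrable fun p : Rn n × Rn n => Θ (p.1 - coeZ μ, p.2 - coeZ ν) :=
  (hΘ.1.continuous.integrable_of_hasCompactSupport hΘ.2).comp_sub_right (coeZ μ, coeZ ν)

/-- Condition (A) recovers the matrix entries from the multiplier. -/
lemma integral_mul_sigmaA (hΦ : IsCcInfty Φ) (hΘ : IsCcInfty Θ) (hφ : IsCutoff φ D)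
    (hΦφ : ∀ p, Φ p ≠ 0 → φ p.1 = 1 ∧ φ p.2 = 1)
    (hA2 : ∀ α β : Zn n, (∫ p : Rn n × Rn n, Θ p * Φ (p.1 - coeZ α, p.2 - coeZ β)) =
      if α = 0 ∧ β = 0 then 1 else 0) {A : Zn n → Zn n → ℂ} (hA : IsLinftyMatrix A) (μ ν : Zn n) :
    ∫ p : Rn n × Rn n, Θ (p.1 - coeZ μ, p.2 - coeZ ν) * sigmaA A Φ p = A μ ν := by
  obtain ⟨M, hM⟩ := exists_norm_sigmaFin_le hΦ hφ hΦφ hA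
  obtain ⟨C, hC⟩ := hΦ.2.exists_bound_of_continuous hΦ.1.continuous
  have hΘi := hΘ.integrable_shift μ ν
  have hlim : Filter.Tendsto (fun S => ∫ p : Rn n × Rn n,
      Θ (p.1 - coeZ μ, p.2 - coeZ ν) * sigmaFin A Φ S p) Filter.atTop
      (nhds (∫ p : Rn n × Rn n, Θ (p.1 - coeZ μ, p.2 - coeZ ν) * sigmaA A Φ p)) := by
    refine tendsto_integral_filter_of_dominated_convergence
      (fun p : Rn n × Rn n => ‖Θ (p.1 - coeZ μ, p.2 - coeZ ν)‖ * M)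
      (Filter.Eventually.of_forall fun S => ?_)
      (Filter.Eventually.of_forall fun S => Filter.Eventually.of_forall fun p => ?_)
      (hΘi.norm.mul_const M) (Filter.Eventually.of_forall fun p => ?_)
    · exact hΘi.aestronglyMeasurable.mul (continuous_sigmaFin hΦ A S).aestronglyMeasurable
    · rw [norm_mul]
      gcongr
      exact hM S p
    · exact (tendsto_sigmaFin hΦ hφ hΦφ hA p).const_mul _
  refine tendsto_nhds_unique hlim (tendsto_const_nhds.congr' ?_)
  classical
  filter_upwards [Filter.eventually_ge_atTop ({μ, ν} : Finset (Zn n))] with S hS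
  have hμ : μ ∈ S := hS (by simp)
  have hν : ν ∈ S := hS (by simp)
  have hi : ∀ α β : Zn n, Integrable fun p : Rn n × Rn n =>
      A α β * (Θ (p.1 - coeZ μ, p.2 - coeZ ν) * Φ (p.1 - coeZ α, p.2 - coeZ β)) := by
    intro α β
    have hΦc := hΦ.1.continuous
    exact (hΘi.mul_bdd (c := C) (Continuous.aestronglyMeasurable (by fun_prop))
      (Filter.Eventually.of_forall fun p => hC _)).const_mul _
  have e : ∀ p : Rn n × Rn n, Θ (p.1 - coeZ μ, p.2 - coeZ ν) * sigmaFin A Φ S p =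
      ∑ α ∈ S, ∑ β ∈ S,
        A α β * (Θ (p.1 - coeZ μ, p.2 - coeZ ν) * Φ (p.1 - coeZ α, p.2 - coeZ β)) := by
    intro p
    simp only [sigmaFin, Finset.mul_sum]
    refine Finset.sum_congr rfl fun α _ => Finset.sum_congr rfl fun β _ => ?_
    ring
  simp_rw [e]
  rw [integral_finsetSum S fun α _ => integrable_finsetSum S fun β _ => hi α β,
    Finset.sum_congr rfl fun α _ => integral_finsetSum S fun β _ => hi α β]
  simp_rw [integral_const_mul, integral_translate_mul_translate hA2]
  rw [Finset.sum_eq_single_of_mem μ hμ, Finset.sum_eq_single_of_mem ν hν]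
  · simp
  · intro β _ hβ
    simp [hβ]
  · intro α _ hα
    simp [hα]

end Recovery

section LowerBound

variable {n : ℕ} {Θ Φ K : Rn n × Rn n → ℂ} {ψ φ : Rn n → ℝ} {D : ℝ≥0}

lemma IsDensity.integral_packet (h : IsDensity Θ K ψ)
    (hΘφ : ∀ p, Θ p ≠ 0 → φ p.1 = 1 ∧ φ p.2 = 1) (F G : Zn n →₀ ℂ) (y : Rn n)
    (p : Rn n × Rn n) :
    ∫ κ : Rn n × Rn n, K (κ.1 - y, κ.2 - y) * (packet φ F κ.1 p.1 * packet φ G κ.2 p.2) =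
      ∑ μ ∈ F.support, ∑ ν ∈ G.support, F μ * G ν * (Θ (p.1 - coeZ μ, p.2 - coeZ ν) *
        chi (y ⬝ᵥ (p.1 - coeZ μ + (p.2 - coeZ ν)))) := by
  have hc := continuous_chi
  set c : Zn n → Zn n → ℂ := fun μ ν => F μ * G ν * φ (p.1 - coeZ μ) * φ (p.2 - coeZ ν) with hcdef
  have hterm : ∀ μ ν : Zn n, F μ * G ν * (Θ (p.1 - coeZ μ, p.2 - coeZ ν) *
      chi (y ⬝ᵥ (p.1 - coeZ μ + (p.2 - coeZ ν)))) = ∫ κ : Rn n × Rn n, c μ ν *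
        (K (κ.1 - y, κ.2 - y) * chi (κ.1 ⬝ᵥ (p.1 - coeZ μ) + κ.2 ⬝ᵥ (p.2 - coeZ ν))) := by
    intro μ ν
    rw [integral_const_mul]
    have hrep := h.rep y (p.1 - coeZ μ, p.2 - coeZ ν)
    simp only at hrep
    rw [← hrep]
    by_cases h0 : Θ (p.1 - coeZ μ, p.2 - coeZ ν) = 0
    · simp [h0]
    · have := hΘφ _ h0
      simp only at this
      simp [hcdef, this.1, this.2]
  have hi : ∀ μ ν : Zn n, Integrable fun κ : Rn n × Rn n => c μ ν *
      (K (κ.1 - y, κ.2 - y) * chi (κ.1 ⬝ᵥ (p.1 - coeZ μ) + κ.2 ⬝ᵥ (p.2 - coeZ ν))) := by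
    intro μ ν
    refine Integrable.const_mul ?_ _
    exact (h.integrable_shift y).mul_bdd (c := 1) (Continuous.aestronglyMeasurable (by fun_prop))
      (Filter.Eventually.of_forall fun κ => (norm_chi _).le)
  simp_rw [hterm]
  rw [← Finset.sum_congr rfl fun μ _ => integral_finsetSum _ fun ν _ => hi μ ν,
    ← integral_finsetSum _ fun μ _ => integrable_finsetSum _ fun ν _ => hi μ ν]
  refine integral_congr_ae (Filter.Eventually.of_forall fun κ => ?_)
  simp only [packet, hcdef]
  rw [Finset.sum_mul_sum]
  simp only [Finset.mul_sum, chi_add]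
  refine Finset.sum_congr rfl fun μ _ => Finset.sum_congr rfl fun ν _ => ?_
  ring

lemma trig_eq_integral_Tgen (hΦ : IsCcInfty Φ) (hΘ : IsCcInfty Θ) (h : IsDensity Θ K ψ)
    (hφ : IsCutoff φ D) (hΦφ : ∀ p, Φ p ≠ 0 → φ p.1 = 1 ∧ φ p.2 = 1)
    (hΘφ : ∀ p, Θ p ≠ 0 → φ p.1 = 1 ∧ φ p.2 = 1)
    (hA2 : ∀ α β : Zn n, (∫ p : Rn n × Rn n, Θ p * Φ (p.1 - coeZ α, p.2 - coeZ β)) =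
      if α = 0 ∧ β = 0 then 1 else 0) {A : Zn n → Zn n → ℂ} (hA : IsLinftyMatrix A)
    (F G : Zn n →₀ ℂ) (y : Rn n) :
    ∑ μ ∈ F.support, ∑ ν ∈ G.support, A μ ν * F μ * G ν * chi (coeZ (μ + ν) ⬝ᵥ y) =
      ∫ κ : Rn n × Rn n, K (κ.1 - -y, κ.2 - -y) *
        Tgen (sigmaA A Φ) (packet φ F κ.1) (packet φ G κ.2) y := by
  have hc := continuous_chi
  obtain ⟨M, hM⟩ := exists_norm_sigmaA_le hΦ hφ hΦφ hA
  have hσm := (stronglyMeasurable_sigmaA hΦ hφ hΦφ hA).aestronglyMeasurable (μ := volume)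
  have hch : Continuous fun p : Rn n × Rn n => chi (y ⬝ᵥ (p.1 + p.2)) := by fun_prop
  have hsw := integral_superposition_swap
    (s := fun p : Rn n × Rn n => chi (y ⬝ᵥ (p.1 + p.2)) * sigmaA A Φ p) (C := M)
    (hch.aestronglyMeasurable.mul hσm)
    (fun p => by rw [norm_mul, norm_chi, one_mul]; exact hM p) (h.integrable_shift (-y))
    (hφ.continuous_packet F) (hφ.continuous_packet G) (hφ.integrable_envelope F)
    (hφ.integrable_envelope G) (hφ.norm_packet_le F) (hφ.norm_packet_le G)
  have hT : ∀ κ : Rn n × Rn n, Tgen (sigmaA A Φ) (packet φ F κ.1) (packet φ G κ.2) y =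
      ∫ p : Rn n × Rn n, chi (y ⬝ᵥ (p.1 + p.2)) * sigmaA A Φ p *
        (packet φ F κ.1 p.1 * packet φ G κ.2 p.2) := by
    intro κ
    rw [Tgen]
    refine integral_congr_ae (Filter.Eventually.of_forall fun p => ?_)
    ring
  simp_rw [hT]
  rw [← hsw]
  simp_rw [h.integral_packet hΘφ]
  have hi : ∀ μ ν : Zn n, Integrable fun p : Rn n × Rn n =>
      F μ * G ν * chi (coeZ (μ + ν) ⬝ᵥ y) *
        (Θ (p.1 - coeZ μ, p.2 - coeZ ν) * sigmaA A Φ p) := by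
    intro μ ν
    exact ((hΘ.integrable_shift μ ν).mul_bdd (c := M) hσm
      (Filter.Eventually.of_forall hM)).const_mul _
  have hterm : ∀ μ ν : Zn n, A μ ν * F μ * G ν * chi (coeZ (μ + ν) ⬝ᵥ y) =
      ∫ p : Rn n × Rn n, F μ * G ν * chi (coeZ (μ + ν) ⬝ᵥ y) *
        (Θ (p.1 - coeZ μ, p.2 - coeZ ν) * sigmaA A Φ p) := by
    intro μ ν
    rw [integral_const_mul, integral_mul_sigmaA hΦ hΘ hφ hΦφ hA2 hA]
    ring
  simp_rw [hterm]
  rw [← Finset.sum_congr rfl fun μ _ => integral_finsetSum _ fun ν _ => hi μ ν,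
    ← integral_finsetSum _ fun μ _ => integrable_finsetSum _ fun ν _ => hi μ ν]
  refine integral_congr_ae (Filter.Eventually.of_forall fun p => ?_)
  simp only [Finset.mul_sum]
  refine Finset.sum_congr rfl fun μ _ => Finset.sum_congr rfl fun ν _ => ?_
  have e : chi (coeZ (μ + ν) ⬝ᵥ y) =
      chi (y ⬝ᵥ (p.1 + p.2)) * chi (-y ⬝ᵥ (p.1 - coeZ μ + (p.2 - coeZ ν))) := by
    rw [← chi_add]
    congr 1
    rw [coeZ_add, dotProduct_comm]
    simp only [neg_dotProduct, dotProduct_add, dotProduct_sub]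
    ring
  rw [e]
  ring

lemma continuous_Tgen_packet {σ : Rn n × Rn n → ℂ} {M : ℝ} (hσ : AEStronglyMeasurable σ)
    (hM : ∀ p, ‖σ p‖ ≤ M) (hφ : IsCutoff φ D) (F G : Zn n →₀ ℂ) :
    Continuous fun z : Rn n × Rn n × Rn n =>
      Tgen σ (packet φ F z.2.1) (packet φ G z.2.2) z.1 := by
  have hc := continuous_chi
  have hp : ∀ F : Zn n →₀ ℂ, ∀ {X : Type} [TopologicalSpace X] {a b : X → Rn n}, Continuous a →
      Continuous b → Continuous fun x => packet φ F (a x) (b x) := fun F _ _ a b ha hb =>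
    (hφ.continuous_packet F).comp (f := fun x => (a x, b x)) (ha.prodMk hb)
  refine continuous_of_dominated (bound := fun p : Rn n × Rn n =>
      M * (envelope φ F p.1 * envelope φ G p.2))
    (fun z => ?_) (fun z => Filter.Eventually.of_forall fun p => ?_)
    (((hφ.integrable_envelope F).mul_prod (hφ.integrable_envelope G)).const_mul M)
    (Filter.Eventually.of_forall fun p => ?_)
  · have h1 : Continuous fun p : Rn n × Rn n => chi (z.1 ⬝ᵥ (p.1 + p.2)) := by fun_prop
    exact ((h1.aestronglyMeasurable.mul hσ).mul
      (hp F continuous_const continuous_fst).aestronglyMeasurable).mul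
      (hp G continuous_const continuous_snd).aestronglyMeasurable
  · rw [norm_mul, norm_mul, norm_mul, norm_chi, one_mul, mul_assoc]
    gcongr
    · exact (norm_nonneg _).trans (hM p)
    · exact hM p
    · exact (norm_nonneg _).trans (hφ.norm_packet_le F z.2.1 _)
    · exact hφ.norm_packet_le _ _ _
    · exact hφ.norm_packet_le _ _ _
  · have h1 : Continuous fun z : Rn n × Rn n × Rn n => chi (z.1 ⬝ᵥ (p.1 + p.2)) := by fun_prop
    have h2 := hp F (continuous_fst.comp (continuous_snd (X := Rn n) (Y := Rn n × Rn n)))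
      (continuous_const (y := p.1))
    have h3 := hp G (continuous_snd.comp (continuous_snd (X := Rn n) (Y := Rn n × Rn n)))
      (continuous_const (y := p.2))
    exact ((h1.mul continuous_const).mul h2).mul h3

lemma sum_enorm_sq_eq_one {F : Zn n →₀ ℂ} (hF : ∑ μ ∈ F.support, ‖F μ‖ ^ 2 = 1) :
    ∑ μ ∈ F.support, ‖F μ‖ₑ ^ 2 = 1 := by
  simp_rw [enorm_sq_eq_ofReal]
  rw [← ENNReal.ofReal_sum_of_nonneg fun _ _ => by positivity, hF, ENNReal.ofReal_one]

lemma lintegral_trig_le (hΦ : IsCcInfty Φ) (hΘ : IsCcInfty Θ) (h : IsDensity Θ K ψ)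
    (hφ : IsCutoff φ D) (hΦφ : ∀ p, Φ p ≠ 0 → φ p.1 = 1 ∧ φ p.2 = 1)
    (hΘφ : ∀ p, Θ p ≠ 0 → φ p.1 = 1 ∧ φ p.2 = 1)
    (hA2 : ∀ α β : Zn n, (∫ p : Rn n × Rn n, Θ p * Φ (p.1 - coeZ α, p.2 - coeZ β)) =
      if α = 0 ∧ β = 0 then 1 else 0) {A : Zn n → Zn n → ℂ} (hA : IsLinftyMatrix A)
    {q : ℝ≥0∞} (hq : 1 ≤ q) {F G : Zn n →₀ ℂ} (hF : ∑ μ ∈ F.support, ‖F μ‖ ^ 2 = 1)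
    (hG : ∑ μ ∈ G.support, ‖G μ‖ ^ 2 = 1) :
    ∫⁻ y in cube n 1, ‖∑ μ ∈ F.support, ∑ ν ∈ G.support,
        A μ ν * F μ * G ν * chi (coeZ (μ + ν) ⬝ᵥ y)‖ₑ ^ 2 ≤
      ((∫⁻ k, ENNReal.ofReal (ψ k)) ^ 2 * (D : ℝ≥0∞) ^ 2 * multNorm q (sigmaA A Φ)) ^ 2 := by
  obtain ⟨M, hM⟩ := exists_norm_sigmaA_le hΦ hφ hΦφ hA
  have hσm := (stronglyMeasurable_sigmaA hΦ hφ hΦφ hA).aestronglyMeasurable (μ := volume)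
  set w : Rn n → ℝ≥0∞ := fun k => ENNReal.ofReal (ψ k) with hw
  have hwm : Measurable w := h.continuous_weight.measurable.ennreal_ofReal
  set I : ℝ≥0∞ := ∫⁻ k, w k
  set T : Rn n → Rn n × Rn n → ℂ := fun y κ =>
    Tgen (sigmaA A Φ) (packet φ F κ.1) (packet φ G κ.2) y with hT
  have hTm : Measurable fun z : Rn n × Rn n × Rn n => ‖T z.1 z.2‖ₑ :=
    (continuous_Tgen_packet hσm hM hφ F G).enorm.measurable
  have hpt : ∀ y ∈ cube n 1, ‖∑ μ ∈ F.support, ∑ ν ∈ G.support,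
      A μ ν * F μ * G ν * chi (coeZ (μ + ν) ⬝ᵥ y)‖ₑ ^ 2 ≤
      I ^ 2 * ∫⁻ κ : Rn n × Rn n, w κ.1 * w κ.2 * ‖T y κ‖ₑ ^ 2 := by
    intro y hy
    have hTy : Measurable fun κ : Rn n × Rn n => ‖T y κ‖ₑ :=
      hTm.comp (g := fun z : Rn n × Rn n × Rn n => ‖T z.1 z.2‖ₑ) (f := fun κ => (y, κ))
        (by fun_prop)
    have h1 : ‖∑ μ ∈ F.support, ∑ ν ∈ G.support,
        A μ ν * F μ * G ν * chi (coeZ (μ + ν) ⬝ᵥ y)‖ₑ ≤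
        ∫⁻ κ : Rn n × Rn n, w κ.1 * w κ.2 * 1 * ‖T y κ‖ₑ := by
      rw [trig_eq_integral_Tgen hΦ hΘ h hφ hΦφ hΘφ hA2 hA F G y]
      refine (enorm_integral_le_lintegral_enorm _).trans (lintegral_mono fun κ => ?_)
      rw [enorm_mul, mul_one]
      gcongr
      exact h.enorm_le (neg_mem_cube hy) κ
    calc _ ≤ _ := pow_le_pow_left₀ zero_le h1 2
      _ ≤ _ := lintegral_weight_mul_sq_le volume (w := fun κ : Rn n × Rn n => w κ.1 * w κ.2)
          (by fun_prop) aemeasurable_const hTy.aemeasurable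
      _ = _ := by
          simp only [one_pow, mul_one]
          rw [lintegral_prod_mul_self w hwm]
  calc _ ≤ ∫⁻ y in cube n 1, I ^ 2 * ∫⁻ κ : Rn n × Rn n, w κ.1 * w κ.2 * ‖T y κ‖ₑ ^ 2 :=
        setLIntegral_mono' (measurableSet_cube 1) hpt
    _ = I ^ 2 * ∫⁻ κ : Rn n × Rn n, w κ.1 * w κ.2 * ∫⁻ y in cube n 1, ‖T y κ‖ₑ ^ 2 := by
        have hm : Measurable (Function.uncurry fun (y : Rn n) (κ : Rn n × Rn n) =>
            w κ.1 * w κ.2 * ‖T y κ‖ₑ ^ 2) := by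
          unfold Function.uncurry
          fun_prop
        have hm' : Measurable fun y : Rn n =>
            ∫⁻ κ : Rn n × Rn n, w κ.1 * w κ.2 * ‖T y κ‖ₑ ^ 2 := hm.lintegral_prod_right'
        rw [lintegral_const_mul _ hm', lintegral_lintegral_swap hm.aemeasurable]
        congr 1
        refine lintegral_congr fun κ => ?_
        rw [lintegral_const_mul]
        exact (hTm.comp (g := fun z : Rn n × Rn n × Rn n => ‖T z.1 z.2‖ₑ) (f := fun y => (y, κ))
          (by fun_prop)).pow_const 2
    _ ≤ I ^ 2 * ∫⁻ κ : Rn n × Rn n, w κ.1 * w κ.2 *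
          (multNorm q (sigmaA A Φ) ^ 2 * ((D : ℝ≥0∞) ^ 2 * (D : ℝ≥0∞) ^ 2)) := by
        gcongr with κ
        refine (lintegral_Tgen_le hq _ (hφ.isCcInfty_packet F κ.1)
          (hφ.isCcInfty_packet G κ.2)).trans ?_
        have hF' := hφ.lintegral_packet_le F κ.1
        have hG' := hφ.lintegral_packet_le G κ.2
        rw [sum_enorm_sq_eq_one hF, mul_one] at hF'
        rw [sum_enorm_sq_eq_one hG, mul_one] at hG'
        gcongr
    _ = _ := by
        rw [lintegral_mul_const _ (by fun_prop), lintegral_prod_mul_self w hwm]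
        ring

lemma trilinear_eq_integral (A : Zn n → Zn n → ℂ) (F G H : Zn n →₀ ℂ) :
    ∑ μ ∈ F.support, ∑ ν ∈ G.support, A μ ν * F μ * G ν * H (μ + ν) =
      ∫ y in cube n 1, (∑ μ ∈ F.support, ∑ ν ∈ G.support,
          A μ ν * F μ * G ν * chi (coeZ (μ + ν) ⬝ᵥ y)) *
        ∑ τ ∈ H.support, H τ * chi (-(coeZ τ ⬝ᵥ y)) := by
  classical
  have hc := continuous_chi
  have hH : ∀ μ ν : Zn n, ∫ y in cube n 1, chi (coeZ (μ + ν) ⬝ᵥ y) *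
      ∑ τ ∈ H.support, H τ * chi (-(coeZ τ ⬝ᵥ y)) = H (μ + ν) := by
    intro μ ν
    have e : ∀ y : Rn n, chi (coeZ (μ + ν) ⬝ᵥ y) * ∑ τ ∈ H.support, H τ * chi (-(coeZ τ ⬝ᵥ y)) =
        ∑ τ ∈ H.support, H τ * chi (coeZ (μ + ν - τ) ⬝ᵥ y) := by
      intro y
      rw [Finset.mul_sum]
      refine Finset.sum_congr rfl fun τ _ => ?_
      rw [coeZ_sub, sub_dotProduct, chi_sub]
      ring
    simp_rw [e]
    rw [integral_finsetSum _ fun τ _ => integrableOn_cube_of_continuous (by fun_prop)]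
    simp_rw [integral_const_mul, integral_chi_cube, sub_eq_zero]
    simpa using fun h => h.symm
  simp_rw [Finset.sum_mul]
  rw [integral_finsetSum _ fun μ _ => integrableOn_cube_of_continuous (by fun_prop)]
  refine Finset.sum_congr rfl fun μ _ => ?_
  rw [integral_finsetSum _ fun ν _ => integrableOn_cube_of_continuous (by fun_prop)]
  refine Finset.sum_congr rfl fun ν _ => ?_
  rw [← hH μ ν, ← integral_const_mul]
  refine integral_congr_ae (Filter.Eventually.of_forall fun y => ?_)
  ring

lemma normB_le (hΦ : IsCcInfty Φ) (hΘ : IsCcInfty Θ) (h : IsDensity Θ K ψ)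
    (hφ : IsCutoff φ D) (hΦφ : ∀ p, Φ p ≠ 0 → φ p.1 = 1 ∧ φ p.2 = 1)
    (hΘφ : ∀ p, Θ p ≠ 0 → φ p.1 = 1 ∧ φ p.2 = 1)
    (hA2 : ∀ α β : Zn n, (∫ p : Rn n × Rn n, Θ p * Φ (p.1 - coeZ α, p.2 - coeZ β)) =
      if α = 0 ∧ β = 0 then 1 else 0) {A : Zn n → Zn n → ℂ} (hA : IsLinftyMatrix A)
    {q : ℝ≥0∞} (hq : 1 ≤ q) :
    normB A ≤
      ((∫⁻ k, ENNReal.ofReal (ψ k)) ^ 2 * (D : ℝ≥0∞) ^ 2) * multNorm q (sigmaA A Φ) := by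
  have hc := continuous_chi
  refine iSup_le fun F => iSup_le fun G => iSup_le fun H => iSup_le fun hF => iSup_le fun hG =>
    iSup_le fun hH => ?_
  change ‖(_ : ℂ)‖ₑ ≤ _
  rw [trilinear_eq_integral, ← ENNReal.pow_le_pow_left_iff two_ne_zero]
  set P : Rn n → ℂ := fun y => ∑ μ ∈ F.support, ∑ ν ∈ G.support,
    A μ ν * F μ * G ν * chi (coeZ (μ + ν) ⬝ᵥ y) with hP
  set Q : Rn n → ℂ := fun y => ∑ τ ∈ H.support, H τ * chi (-(coeZ τ ⬝ᵥ y)) with hQ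
  have hPc : Continuous P := by fun_prop
  have hQc : Continuous Q := by fun_prop
  have hQ1 : ∫⁻ y in cube n 1, ‖Q y‖ₑ ^ 2 = 1 := by
    have e : ∀ y, ‖Q y‖ₑ = ‖∑ τ ∈ H.support, (starRingEnd ℂ) (H τ) * chi (coeZ τ ⬝ᵥ y)‖ₑ := by
      intro y
      rw [← ofReal_norm, ← ofReal_norm, ← RCLike.norm_conj (Q y)]
      simp only [hQ, map_sum, map_mul, conj_chi, neg_neg]
    simp_rw [e]
    rw [parseval_cube]
    have e2 : ∀ z : ℂ, ‖(starRingEnd ℂ) z‖ₑ = ‖z‖ₑ := fun z => by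
      rw [← ofReal_norm, ← ofReal_norm, RCLike.norm_conj]
    simp_rw [e2]
    exact sum_enorm_sq_eq_one hH
  have h1 : ‖∫ y in cube n 1, P y * Q y‖ₑ ≤ ∫⁻ y in cube n 1, 1 * ‖P y‖ₑ * ‖Q y‖ₑ := by
    refine (enorm_integral_le_lintegral_enorm _).trans (lintegral_mono fun y => ?_)
    rw [enorm_mul, one_mul]
  have h2 := lintegral_weight_mul_sq_le (volume.restrict (cube n 1)) (w := fun _ => 1)
    aemeasurable_const hPc.enorm.measurable.aemeasurable hQc.enorm.measurable.aemeasurable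
  simp only [one_mul, hQ1, mul_one] at h1 h2
  exact (pow_le_pow_left₀ zero_le h1 2).trans
    (h2.trans (lintegral_trig_le hΦ hΘ h hφ hΦφ hΘφ hA2 hA hq hF hG))

end LowerBound

/-- If `Φ ∈ C_c^∞(ℝ^n × ℝ^n)` satisfies condition (A), then there exists
`c ∈ (0,∞)` depending only on `n` and `Φ` such that for every `L^∞` matrix `A` and every
`1 ≤ q ≤ ∞`, `c⁻¹ ‖A‖_B ≤ ‖σ_{A,Φ}‖_{M(L²×L² → (L²,ℓ^q))} ≤ c ‖A‖_B`. -/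
theorem statement2 (n : ℕ) (Φ : Rn n × Rn n → ℂ) (hΦ : IsCcInfty Φ) (hcondA : ConditionA2 Φ) :
    ∃ c : ℝ≥0∞, 0 < c ∧ c < ∞ ∧
      ∀ A : Zn n → Zn n → ℂ, IsLinftyMatrix A →
        ∀ q : ℝ≥0∞, 1 ≤ q →
          c⁻¹ * normB A ≤ multNorm q (sigmaA A Φ) ∧
          multNorm q (sigmaA A Φ) ≤ c * normB A := by
  obtain ⟨Θ, hΘs, hΘc, hA2⟩ := hcondA
  have hΘ : IsCcInfty Θ := ⟨hΘs, hΘc⟩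
  obtain ⟨φ, D, hφ, hΦφ, hΘφ⟩ := exists_cutoff_of_hasCompactSupport hΦ.2 hΘc
  obtain ⟨K₁, ψ₁, h₁⟩ := exists_isDensity hΦ
  obtain ⟨K₂, ψ₂, h₂⟩ := exists_isDensity hΘ
  set C₁ : ℝ≥0∞ := (∫⁻ k, ENNReal.ofReal (ψ₁ k)) ^ 2 * (D : ℝ≥0∞) ^ 2
  set C₂ : ℝ≥0∞ := (∫⁻ k, ENNReal.ofReal (ψ₂ k)) ^ 2 * (D : ℝ≥0∞) ^ 2
  have hD : (D : ℝ≥0∞) ^ 2 < ∞ := ENNReal.pow_lt_top ENNReal.coe_lt_top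
  have hC₁ : C₁ < ∞ := ENNReal.mul_lt_top (ENNReal.pow_lt_top h₁.lintegral_weight_lt_top) hD
  have hC₂ : C₂ < ∞ := ENNReal.mul_lt_top (ENNReal.pow_lt_top h₂.lintegral_weight_lt_top) hD
  have hc0 : 0 < C₁ + C₂ + 1 := zero_lt_one.trans_le le_add_self
  have hctop : C₁ + C₂ + 1 < ∞ := by simp [hC₁, hC₂]
  refine ⟨C₁ + C₂ + 1, hc0, hctop, fun A hA q hq => ⟨?_, ?_⟩⟩
  · rw [ENNReal.inv_mul_le_iff hc0.ne' hctop.ne]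
    refine (normB_le hΦ hΘ h₂ hφ hΦφ hΘφ hA2 hA hq).trans ?_
    gcongr
    exact le_add_self.trans le_self_add
  · refine (multNorm_le hΦ h₁ hφ hΦφ hA hq).trans ?_
    gcongr
    exact le_self_add.trans le_self_add
end

section
/- Let σ_{μν} ∈ L^∞(ℝ^n × ℝ^n) be given for each (μ,ν) ∈ ℤ^n × ℤ^n and assume: (i) sup_{μ,ν} ‖σ_{μν}‖_{L^∞} < ∞; (ii) there exists K ∈ (0,∞) such that supp σ_{μν} ⊂ (μ,ν) + KQ × KQ for all μ, ν; (iii) there exists M ∈ [0,∞) such that ‖Σ_{μ,ν∈ℤ^n} α_μ α′_ν σ_{μν}‖_{M(L²×L² → (L²,ℓ^∞))} ≤ M for all choices of α_μ ∈ {0,1} and α′_ν ∈ {0,1}. Then for each Φ ∈ C_c^∞(ℝ^n × ℝ^n) there exists a constant c, depending only on n, K, Φ, such that ‖Σ_{μ,ν∈ℤ^n} Φ(ξ−μ, η−ν) σ_{μν}(ξ,η)‖_{M(L²×L² → (L²,ℓ^∞))} ≤ cM. -/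
open MeasureTheory Complex
open scoped ENNReal NNReal

namespace BilinearMultiplier

open Filter Topology

/-- The character `y ↦ e^{2πi x·y}`. -/
noncomputable def char {n : ℕ} (x y : Rn n) : ℂ :=
  Complex.exp ((2 * Real.pi * Complex.I) * ((∑ i, x i * y i : ℝ) : ℂ))

lemma norm_char {n : ℕ} (x y : Rn n) : ‖char x y‖ = 1 := by
  rw [char, show (2 * Real.pi * Complex.I) * ((∑ i, x i * y i : ℝ) : ℂ)
    = ((2 * Real.pi * ∑ i, x i * y i : ℝ) : ℂ) * Complex.I by push_cast; ring]
  exact Complex.norm_exp_ofReal_mul_I _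

lemma continuous_char {n : ℕ} : Continuous fun p : Rn n × Rn n => char p.1 p.2 := by
  unfold char; fun_prop

lemma measurable_char {n : ℕ} {X : Type*} [MeasurableSpace X] {u v : X → Rn n}
    (hu : Measurable u) (hv : Measurable v) : Measurable fun x => char (u x) (v x) :=
  continuous_char.measurable.comp (hu.prodMk hv)

lemma char_add_right {n : ℕ} (x y z : Rn n) : char x (y + z) = char x y * char x z := by
  rw [char, char, char, ← Complex.exp_add, ← mul_add, ← Complex.ofReal_add,
    ← Finset.sum_add_distrib]
  simp only [Pi.add_apply, mul_add]

lemma char_add_left {n : ℕ} (x y z : Rn n) : char (x + y) z = char x z * char y z := by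
  rw [char, char, char, ← Complex.exp_add, ← mul_add, ← Complex.ofReal_add,
    ← Finset.sum_add_distrib]
  simp only [Pi.add_apply, add_mul]

lemma ft_eq_integral_char {n : ℕ} (f : SchwartzMap (Rn n) ℂ) (ξ : Rn n) :
    ft f ξ = ∫ x : Rn n, char x (-ξ) * f x := by
  unfold ft char
  congr 1; ext x; congr 2
  push_cast
  simp only [Pi.neg_apply, Complex.ofReal_neg, mul_neg, Finset.sum_neg_distrib]
  ring

lemma ft_compSubConst {n : ℕ} (f : SchwartzMap (Rn n) ℂ) (s ξ : Rn n) :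
    ft (f.compSubConstCLM ℂ (-s)) ξ = char s ξ * ft f ξ := by
  rw [ft_eq_integral_char, ft_eq_integral_char,
    ← integral_sub_right_eq_self (fun x => char x (-ξ) * _) s, ← integral_const_mul]
  congr 1; ext x
  have h : char (x - s) (-ξ) = char s ξ * char x (-ξ) := by
    rw [sub_eq_add_neg, char_add_left, mul_comm]
    congr 1
    simp [char]
  rw [h, SchwartzMap.compSubConstCLM_apply]
  simp [mul_assoc]

lemma eLpNorm_compSubConst {n : ℕ} (f : SchwartzMap (Rn n) ℂ) (s : Rn n) :
    eLpNorm (⇑(f.compSubConstCLM ℂ s)) 2 volume = eLpNorm (⇑f) 2 volume :=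
  eLpNorm_comp_measurePreserving (f := fun x : Rn n => x - s) f.continuous.aestronglyMeasurable
    (measurePreserving_sub_right volume s)

lemma exists_ft_eq_comp {n : ℕ} (f : SchwartzMap (Rn n) ℂ) :
    ∃ F : SchwartzMap (EuclideanSpace ℝ (Fin n)) ℂ, ∀ ξ, ft f ξ = F (WithLp.toLp 2 ξ) := by
  let e : EuclideanSpace ℝ (Fin n) ≃L[ℝ] Rn n := PiLp.continuousLinearEquiv 2 ℝ _
  refine ⟨FourierTransform.fourier (SchwartzMap.compCLMOfContinuousLinearEquiv ℂ e f),
    fun ξ => ?_⟩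
  rw [SchwartzMap.fourier_coe, Real.fourier_eq',
    ← (PiLp.volume_preserving_toLp (Fin n)).integral_comp
      (MeasurableEquiv.toLp 2 _).measurableEmbedding]
  unfold ft
  congr 1; ext x
  simp only [smul_eq_mul, SchwartzMap.compCLMOfContinuousLinearEquiv_apply, Function.comp_apply]
  congr 2
  have h : inner ℝ (WithLp.toLp 2 x) (WithLp.toLp 2 ξ) = ∑ i, x i * ξ i := by
    simp [PiLp.inner_apply, mul_comm]
  rw [h]
  push_cast
  ring

lemma continuous_ft {n : ℕ} (f : SchwartzMap (Rn n) ℂ) : Continuous (ft f) := by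
  obtain ⟨F, hF⟩ := exists_ft_eq_comp f
  rw [funext hF]
  exact F.continuous.comp (PiLp.continuous_toLp 2 _)

lemma integrable_ft {n : ℕ} (f : SchwartzMap (Rn n) ℂ) : Integrable (ft f) := by
  obtain ⟨F, hF⟩ := exists_ft_eq_comp f
  rw [funext hF]
  exact (PiLp.volume_preserving_toLp (Fin n)).integrable_comp_of_integrable F.integrable

lemma Tbil_compSubConst {n : ℕ} (σ : Rn n × Rn n → ℂ) (f g : SchwartzMap (Rn n) ℂ)
    (s t x : Rn n) :
    Tbil σ (f.compSubConstCLM ℂ (-s)) (g.compSubConstCLM ℂ (-t)) x =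
      ∫ p : Rn n × Rn n, char x (p.1 + p.2) * (char s p.1 * char t p.2 * σ p) *
        ft f p.1 * ft g p.2 := by
  unfold Tbil
  congr 1; ext p
  rw [ft_compSubConst, ft_compSubConst]
  simp only [char, Pi.add_apply]
  ring

lemma localL2_sq {n : ℕ} (h : Rn n → ℂ) (ν : Zn n) :
    localL2 h ν ^ 2 = ∫⁻ x in cube n 1, ‖h (x + coeZ ν)‖ₑ ^ 2 := by
  rw [localL2, ← ENNReal.rpow_natCast, ← ENNReal.rpow_mul, Nat.cast_ofNat,
    one_div_mul_cancel two_ne_zero, ENNReal.rpow_one]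
  rfl

lemma localL2_le_multNorm {n : ℕ} (σ : Rn n × Rn n → ℂ) (f g : SchwartzMap (Rn n) ℂ)
    (hf : eLpNorm (⇑f) 2 volume = 1) (hg : eLpNorm (⇑g) 2 volume = 1) (ν : Zn n) :
    localL2 (Tbil σ f g) ν ≤ multNorm ⊤ σ := by
  have h : amalgamNorm ⊤ (Tbil σ f g) ≤ multNorm ⊤ σ := by
    unfold multNorm
    exact le_iSup_of_le f (le_iSup_of_le g (le_iSup_of_le hf (le_iSup_of_le hg le_rfl)))
  refine le_trans ?_ h
  rw [amalgamNorm, if_pos rfl]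
  exact le_iSup (fun ν => localL2 (Tbil σ f g) ν) ν

/-- Translates of a fixed cube contain boundedly many lattice points. -/
lemma exists_card_lattice_le (n : ℕ) (K : ℝ) :
    ∃ N : ℕ, ∀ ξ : Rn n, ∃ s : Finset (Zn n), s.card ≤ N ∧
      ∀ μ, ξ - coeZ μ ∈ cube n K → μ ∈ s := by
  refine ⟨(⌊K⌋ + 1).toNat ^ n, fun ξ =>
    ⟨Fintype.piFinset fun i => Finset.Icc ⌈ξ i - K / 2⌉ ⌊ξ i + K / 2⌋, ?_, fun μ hμ => ?_⟩⟩
  · rw [Fintype.card_piFinset]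
    refine (Finset.prod_le_pow_card _ _ (⌊K⌋ + 1).toNat fun i _ => ?_).trans (by simp)
    rw [Int.card_Icc]
    apply Int.toNat_le_toNat
    have h1 := Int.le_ceil (ξ i - K / 2)
    have h2 := Int.floor_le (ξ i + K / 2)
    have : ⌊ξ i + K / 2⌋ - ⌈ξ i - K / 2⌉ ≤ ⌊K⌋ := by
      rw [Int.le_floor]; push_cast; linarith
    omega
  · rw [Fintype.mem_piFinset]
    intro i
    have h := hμ i (Set.mem_univ i)
    simp only [coeZ, Pi.sub_apply, Set.mem_Icc] at h
    rw [Finset.mem_Icc, Int.ceil_le, Int.le_floor]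
    constructor <;> linarith [h.1, h.2]

/-- A Minkowski-type inequality: weighted averages of functions bounded in `L²`. -/
lemma lintegral_sq_integral_le {Ω X : Type*} [MeasurableSpace Ω] [MeasurableSpace X]
    (m : Measure Ω) (ρ : Measure X) [SFinite m] [SFinite ρ] (W : Ω → ℂ) (hW : Measurable W)
    (F : Ω → X → ℂ) (hF : Measurable (Function.uncurry F)) (N : ℝ≥0∞)
    (hN : ∀ ω, ∫⁻ x, ‖F ω x‖ₑ ^ 2 ∂ρ ≤ N) :
    ∫⁻ x, ‖∫ ω, W ω * F ω x ∂m‖ₑ ^ 2 ∂ρ ≤ (∫⁻ ω, ‖W ω‖ₑ ∂m) ^ 2 * N := by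
  have hFx (x : X) : Measurable fun ω => F ω x := hF.comp measurable_prodMk_right
  have key (x : X) : ‖∫ ω, W ω * F ω x ∂m‖ₑ ^ 2 ≤
      (∫⁻ ω, ‖W ω‖ₑ ∂m) * ∫⁻ ω, ‖W ω‖ₑ * ‖F ω x‖ₑ ^ 2 ∂m := by
    have h1 : ‖∫ ω, W ω * F ω x ∂m‖ₑ ≤ ∫⁻ ω, ‖W ω‖ₑ ^ (1 / 2 : ℝ) *
        (‖W ω‖ₑ ^ (1 / 2 : ℝ) * ‖F ω x‖ₑ) ∂m := by
      refine (enorm_integral_le_lintegral_enorm _).trans_eq (lintegral_congr fun ω => ?_)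
      rw [enorm_mul, ← mul_assoc, ← ENNReal.rpow_add_of_nonneg _ _ (by norm_num) (by norm_num)]
      norm_num
    have h2 := h1.trans (ENNReal.lintegral_mul_le_Lp_mul_Lq m Real.HolderConjugate.two_two
      (hW.enorm.pow_const _).aemeasurable
      ((hW.enorm.pow_const _).mul (hFx x).enorm).aemeasurable)
    have h3 := pow_le_pow_left' h2 2
    refine h3.trans_eq ?_
    have h4 (a : ℝ≥0∞) : (a ^ (1 / 2 : ℝ)) ^ 2 = a := by
      rw [← ENNReal.rpow_natCast, ← ENNReal.rpow_mul]; norm_num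
    simp only [mul_pow, h4, ENNReal.rpow_two]
  calc ∫⁻ x, ‖∫ ω, W ω * F ω x ∂m‖ₑ ^ 2 ∂ρ
      ≤ ∫⁻ x, (∫⁻ ω, ‖W ω‖ₑ ∂m) * ∫⁻ ω, ‖W ω‖ₑ * ‖F ω x‖ₑ ^ 2 ∂m ∂ρ := lintegral_mono key
    _ = (∫⁻ ω, ‖W ω‖ₑ ∂m) * ∫⁻ ω, ∫⁻ x, ‖W ω‖ₑ * ‖F ω x‖ₑ ^ 2 ∂ρ ∂m := by
      have hmeas : Measurable fun q : X × Ω => ‖W q.2‖ₑ * ‖F q.2 q.1‖ₑ ^ 2 :=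
        (hW.comp measurable_snd).enorm.mul
          ((hF.comp measurable_swap).enorm.pow_const 2)
      rw [lintegral_const_mul _ hmeas.lintegral_prod_right',
        lintegral_lintegral_swap hmeas.aemeasurable]
    _ ≤ (∫⁻ ω, ‖W ω‖ₑ ∂m) * ∫⁻ ω, ‖W ω‖ₑ * N ∂m := by
      gcongr with ω
      have hFω : Measurable (F ω) := hF.comp measurable_prodMk_left
      rw [lintegral_const_mul _ (hFω.enorm.pow_const 2)]
      gcongr
      exact hN ω
    _ = (∫⁻ ω, ‖W ω‖ₑ ∂m) ^ 2 * N := by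
      rw [lintegral_mul_const _ hW.enorm]; ring

/-- A unimodular number is an average, over a disc, of `0`-`1` coefficients. -/
lemma exists_sector_average : ∃ κ : ℂ, κ ≠ 0 ∧ ∀ z : ℂ, ‖z‖ = 1 →
    ∫ c in Metric.ball (0 : ℂ) 1, c * (if 0 < ((starRingEnd ℂ) c * z).re then 1 else 0) =
      κ * z := by
  set φ : ℂ → ℂ := fun c => c * (if 0 < c.re then 1 else 0) with hφ
  have hφm : Measurable φ := measurable_id.mul
    (Measurable.ite (measurableSet_lt measurable_const Complex.measurable_re)
      measurable_const measurable_const)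
  have hφi : IntegrableOn φ (Metric.ball (0 : ℂ) 1) := by
    refine Measure.integrableOn_of_bounded (M := 1) measure_ball_lt_top.ne
      hφm.aestronglyMeasurable ?_
    refine (ae_restrict_iff' Metric.isOpen_ball.measurableSet).2 (Eventually.of_forall ?_)
    intro c hc
    rw [mem_ball_zero_iff] at hc
    simp only [hφ]
    split_ifs
    · simpa using hc.le
    · simp
  refine ⟨∫ c in Metric.ball (0 : ℂ) 1, φ c, ?_, fun z hz => ?_⟩
  · intro h0
    have h1 : ∫ c in Metric.ball (0 : ℂ) 1, (φ c).re = 0 := by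
      have := integral_re (𝕜 := ℂ) hφi
      simp only [RCLike.re_to_complex] at this
      rw [this, h0, Complex.zero_re]
    have h2 : (φ · |>.re) = fun c : ℂ => max c.re 0 := by
      ext c
      simp only [hφ]
      split_ifs with h
      · simp [h.le]
      · simp [not_lt.1 h]
    rw [h2] at h1
    have h3 : 0 < ∫ c in Metric.ball (0 : ℂ) 1, max c.re 0 := by
      rw [setIntegral_pos_iff_support_of_nonneg_ae (f := fun c : ℂ => max c.re 0)
        (Eventually.of_forall fun c => le_max_right _ _) (by rw [← h2]; exact hφi.re)]
      refine ((((isOpen_lt continuous_const Complex.continuous_re).inter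
        (Metric.isOpen_ball (x := (0 : ℂ)) (ε := 1))).measure_pos volume
        ⟨(1 / 2 : ℂ), show (0 : ℝ) < (1 / 2 : ℂ).re by norm_num, ?_⟩)).trans_le (measure_mono ?_)
      · simp; norm_num
      · rintro c ⟨hc, hc'⟩
        exact ⟨(lt_max_of_lt_left hc).ne', hc'⟩
    exact h3.ne' h1
  · let e : ℂ ≃ₗᵢ[ℝ] ℂ := rotation ⟨z, by simpa [Submonoid.unitSphere] using hz⟩
    have he (c : ℂ) : e c = z * c := rfl
    have hpre : e ⁻¹' Metric.ball (0 : ℂ) 1 = Metric.ball 0 1 := by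
      ext c; simp
    rw [← e.measurePreserving.setIntegral_preimage_emb e.toHomeomorph.measurableEmbedding, hpre,
      ← integral_mul_const]
    congr 1; ext c
    have h : (starRingEnd ℂ) (z * c) * z = (starRingEnd ℂ) c := by
      rw [map_mul, mul_right_comm, mul_comm _ z, Complex.mul_conj, Complex.normSq_eq_norm_sq, hz]
      simp
    simp only [hφ, he, h, Complex.conj_re]
    ring

/-- Fourier representation of a smooth compactly supported function. -/
lemma exists_fourier_representation {n : ℕ} {Φ : Rn n × Rn n → ℂ} (hΦ : IsCcInfty Φ) :
    ∃ w : SchwartzMap (EuclideanSpace ℝ (Fin n ⊕ Fin n)) ℂ, ∀ p : Rn n × Rn n,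
      Φ p = ∫ v, w v * (char (fun i => v (Sum.inl i)) p.1 * char (fun i => v (Sum.inr i)) p.2) := by
  let E := EuclideanSpace ℝ (Fin n ⊕ Fin n)
  let e : E ≃L[ℝ] Rn n × Rn n := (PiLp.continuousLinearEquiv 2 ℝ _).trans
    (ContinuousLinearEquiv.sumPiEquivProdPi ℝ (Fin n) (Fin n) fun _ => ℝ)
  let ψ : SchwartzMap E ℂ := HasCompactSupport.toSchwartzMap (f := Φ ∘ e)
    (hΦ.2.comp_homeomorph e.toHomeomorph) (hΦ.1.comp e.contDiff)
  refine ⟨FourierTransform.fourier ψ, fun p => ?_⟩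
  have h1 : Φ p = ψ (e.symm p) := by
    change Φ p = Φ (e (e.symm p)); simp
  have h2 : ψ = FourierTransformInv.fourierInv (FourierTransform.fourier ψ) := by simp
  rw [h1, h2, SchwartzMap.fourierInv_coe, Real.fourierInv_eq']
  simp only [FourierTransform.fourier_fourierInv_eq]
  congr 1; ext v
  rw [smul_eq_mul, mul_comm, char, char, ← Complex.exp_add]
  congr 2
  have : inner ℝ v (e.symm p) =
      ∑ i, v (Sum.inl i) * p.1 i + ∑ i, v (Sum.inr i) * p.2 i := by
    rw [PiLp.inner_apply, Fintype.sum_sum_type]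
    congr 1 <;> refine Finset.sum_congr rfl fun i _ => ?_
    · simp only [RCLike.inner_apply, conj_trivial]; rw [mul_comm]; rfl
    · simp only [RCLike.inner_apply, conj_trivial]; rw [mul_comm]; rfl
  rw [this]
  push_cast
  ring

/-- Superpositions of modulated multipliers. -/
lemma multNorm_integral_le {n : ℕ} {Ω : Type*} [MeasurableSpace Ω]
    (m : Measure Ω) [SFinite m] {W : Ω → ℂ} (hWm : Measurable W) (hW : Integrable W m)
    {s t : Ω → Rn n} (hs : Measurable s) (ht : Measurable t) {S : Ω → Rn n × Rn n → ℂ}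
    (hSm : Measurable (Function.uncurry S)) {C : ℝ} (hSb : ∀ ω p, ‖S ω p‖ ≤ C) {M : ℝ≥0∞}
    (hM : ∀ ω, multNorm ⊤ (S ω) ≤ M) :
    multNorm ⊤ (fun p => ∫ ω, W ω * (char (s ω) p.1 * char (t ω) p.2 * S ω p) ∂m)
      ≤ (∫⁻ ω, ‖W ω‖ₑ ∂m) * M := by
  set B : Ω → Rn n × Rn n → ℂ := fun ω p =>
    char (s ω) p.1 * char (t ω) p.2 * S ω p with hB
  have hBm : Measurable (Function.uncurry B) := by
    refine Measurable.mul (Measurable.mul ?_ ?_) hSm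
    · exact measurable_char (hs.comp measurable_fst) (measurable_fst.comp measurable_snd)
    · exact measurable_char (ht.comp measurable_fst) (measurable_snd.comp measurable_snd)
  have hBb (ω p) : ‖B ω p‖ ≤ C := by
    simp only [hB, norm_mul, norm_char, one_mul]
    exact hSb ω p
  clear_value B
  unfold multNorm
  refine iSup_le fun f => iSup_le fun g => iSup_le fun hf => iSup_le fun hg => ?_
  rw [amalgamNorm, if_pos rfl]
  refine iSup_le fun κ => ?_
  set F : Ω → Rn n → ℂ := fun ω x => Tbil (S ω) (f.compSubConstCLM ℂ (-s ω))
    (g.compSubConstCLM ℂ (-t ω)) x with hF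
  have hFB (ω x) : F ω x = ∫ p : Rn n × Rn n, char x (p.1 + p.2) * B ω p *
      ft f p.1 * ft g p.2 := by
    rw [hB]; exact Tbil_compSubConst _ _ _ _ _ _
  have hG : Measurable fun r : (Ω × Rn n) × (Rn n × Rn n) =>
      char r.1.2 (r.2.1 + r.2.2) * B r.1.1 r.2 * ft f r.2.1 * ft g r.2.2 := by
    have h1 : Measurable fun r : (Ω × Rn n) × (Rn n × Rn n) => char r.1.2 (r.2.1 + r.2.2) :=
      measurable_char (by fun_prop) (by fun_prop)
    have h2 : Measurable fun r : (Ω × Rn n) × (Rn n × Rn n) => B r.1.1 r.2 :=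
      hBm.comp (f := fun r : (Ω × Rn n) × (Rn n × Rn n) => (r.1.1, r.2)) (by fun_prop)
    have h3 : Measurable fun r : (Ω × Rn n) × (Rn n × Rn n) => ft f r.2.1 :=
      (continuous_ft f).measurable.comp (by fun_prop)
    have h4 : Measurable fun r : (Ω × Rn n) × (Rn n × Rn n) => ft g r.2.2 :=
      (continuous_ft g).measurable.comp (by fun_prop)
    exact ((h1.mul h2).mul h3).mul h4
  have hFm : Measurable (Function.uncurry F) := by
    have : Function.uncurry F = fun q : Ω × Rn n => ∫ p : Rn n × Rn n,
        char q.2 (p.1 + p.2) * B q.1 p * ft f p.1 * ft g p.2 := by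
      ext q; exact hFB _ _
    rw [this]
    exact (hG.stronglyMeasurable.integral_prod_right').measurable
  have hTF (x : Rn n) : Tbil (fun p => ∫ ω, W ω * B ω p ∂m) f g x =
        ∫ ω, W ω * F ω x ∂m := by
    simp_rw [hFB, ← integral_const_mul]
    rw [integral_integral_swap]
    · unfold Tbil
      congr 1; ext p
      rw [show ∀ u v w z : ℂ, u * v * w * z = v * (u * w * z) by intros; ring,
        ← integral_mul_const]
      congr 1; ext ω
      simp only [char, Pi.add_apply]
      ring
    · refine Integrable.mono' (g := fun q : Ω × (Rn n × Rn n) => ‖W q.1‖ *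
        ((C) * (‖ft f q.2.1‖ * ‖ft g q.2.2‖))) ?_ ?_ ?_
      · exact hW.norm.mul_prod (((integrable_ft f).norm.mul_prod
          (integrable_ft g).norm).const_mul _)
      · have h1 : Measurable fun q : Ω × (Rn n × Rn n) => W q.1 := hWm.comp measurable_fst
        have h2 : Measurable fun q : Ω × (Rn n × Rn n) =>
            char x (q.2.1 + q.2.2) * B q.1 q.2 * ft f q.2.1 * ft g q.2.2 :=
          hG.comp (f := fun q : Ω × (Rn n × Rn n) => ((q.1, x), q.2)) (by fun_prop)
        exact (h1.mul h2).aestronglyMeasurable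
      · refine Eventually.of_forall fun q => ?_
        simp only [Function.uncurry, norm_mul, norm_char, one_mul]
        rw [mul_assoc ‖B _ _‖]
        gcongr
        exact hBb _ _
  have hloc (ω : Ω) : ∫⁻ x in cube n 1, ‖F ω (x + coeZ κ)‖ₑ ^ 2 ≤ M ^ 2 := by
    rw [← localL2_sq]
    exact pow_le_pow_left' ((localL2_le_multNorm _ _ _ (by rwa [eLpNorm_compSubConst])
      (by rwa [eLpNorm_compSubConst]) κ).trans (hM ω)) 2
  clear_value F
  have hFκ : Measurable (Function.uncurry fun ω x => F ω (x + coeZ κ)) :=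
    hFm.comp (f := fun q : Ω × Rn n => (q.1, q.2 + coeZ κ)) (by fun_prop)
  have hmain := lintegral_sq_integral_le m (volume.restrict (cube n 1)) W hWm
    (fun ω x => F ω (x + coeZ κ)) hFκ _ hloc
  rw [← mul_pow] at hmain
  simp_rw [← hTF] at hmain
  rw [← localL2_sq] at hmain
  subst hB
  exact (ENNReal.pow_le_pow_left_iff two_ne_zero).1 hmain

lemma multNorm_tsum_le_of_representation {n : ℕ} {K : ℝ} {Ω : Type*} [MeasurableSpace Ω]
    (m : Measure Ω) [SFinite m] {W : Ω → ℂ} (hWm : Measurable W) (hW : Integrable W m)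
    {s t : Ω → Rn n} (hs : Measurable s) (ht : Measurable t) {a b : Ω → Zn n → ℂ}
    (ham : ∀ μ, Measurable fun ω => a ω μ) (hbm : ∀ μ, Measurable fun ω => b ω μ)
    (ha : ∀ ω μ, a ω μ = 0 ∨ a ω μ = 1) (hb : ∀ ω μ, b ω μ = 0 ∨ b ω μ = 1)
    {Φ : Rn n × Rn n → ℂ}
    (hΦ : ∀ μ ν (p : Rn n × Rn n), Φ (p.1 - coeZ μ, p.2 - coeZ ν) =
      ∫ ω, W ω * (char (s ω) p.1 * char (t ω) p.2 * (a ω μ * b ω ν)) ∂m)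
    {σf : Zn n → Zn n → Rn n × Rn n → ℂ} {M : ℝ≥0} (hσ : ∀ μ ν, Measurable (σf μ ν))
    {C : ℝ} (hC : ∀ μ ν p, ‖σf μ ν p‖ ≤ C)
    (hsupp : ∀ μ ν, ∀ p : Rn n × Rn n, σf μ ν p ≠ 0 →
      p.1 - coeZ μ ∈ cube n K ∧ p.2 - coeZ ν ∈ cube n K)
    (hM : ∀ α α' : Zn n → ℂ, (∀ μ, α μ = 0 ∨ α μ = 1) → (∀ ν, α' ν = 0 ∨ α' ν = 1) →
      multNorm ⊤ (fun p : Rn n × Rn n =>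
        ∑' μν : Zn n × Zn n, α μν.1 * α' μν.2 * σf μν.1 μν.2 p) ≤ (M : ℝ≥0∞)) :
    multNorm ⊤ (fun p : Rn n × Rn n =>
        ∑' μν : Zn n × Zn n, Φ (p.1 - coeZ μν.1, p.2 - coeZ μν.2) * σf μν.1 μν.2 p)
      ≤ (∫⁻ ω, ‖W ω‖ₑ ∂m) * M := by
  have ha1 (ω μ) : ‖a ω μ‖ ≤ 1 := by rcases ha ω μ with h | h <;> simp [h]
  have hb1 (ω μ) : ‖b ω μ‖ ≤ 1 := by rcases hb ω μ with h | h <;> simp [h]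
  have hC0 : 0 ≤ C := (norm_nonneg _).trans (hC 0 0 0)
  obtain ⟨N, hN⟩ := exists_card_lattice_le n K
  have hT (p : Rn n × Rn n) : ∃ T : Finset (Zn n × Zn n), T.card ≤ N * N ∧
      ∀ q ∉ T, σf q.1 q.2 p = 0 := by
    obtain ⟨s₁, h₁, h₁'⟩ := hN p.1
    obtain ⟨s₂, h₂, h₂'⟩ := hN p.2
    refine ⟨s₁ ×ˢ s₂, ?_, fun q hq => ?_⟩
    · rw [Finset.card_product]; exact Nat.mul_le_mul h₁ h₂
    · by_contra h
      have h3 := hsupp _ _ _ h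
      exact hq (Finset.mem_product.2 ⟨h₁' _ h3.1, h₂' _ h3.2⟩)
  set S : Ω → Rn n × Rn n → ℂ := fun ω p =>
    ∑' μν : Zn n × Zn n, a ω μν.1 * b ω μν.2 * σf μν.1 μν.2 p with hS
  have hSm : Measurable (Function.uncurry S) := by
    refine Measurable.tsum fun q => ?_
    exact (((ham q.1).comp measurable_fst).mul ((hbm q.2).comp measurable_fst)).mul
      ((hσ q.1 q.2).comp measurable_snd)
  have hSb (ω p) : ‖S ω p‖ ≤ N * N * C := by
    obtain ⟨T, hTc, hT0⟩ := hT p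
    simp only [hS]
    rw [tsum_eq_sum (s := T) fun q hq => by rw [hT0 q hq, mul_zero]]
    refine (norm_sum_le_of_le T (n := fun _ => C) fun q _ => ?_).trans ?_
    · rw [norm_mul, norm_mul]
      calc _ ≤ 1 * 1 * C := by
            gcongr
            exacts [ha1 _ _, hb1 _ _, hC _ _ _]
        _ = C := by ring
    · rw [Finset.sum_const, nsmul_eq_mul]
      gcongr
      exact_mod_cast hTc
  have hrep (p : Rn n × Rn n) :
      ∑' μν : Zn n × Zn n, Φ (p.1 - coeZ μν.1, p.2 - coeZ μν.2) * σf μν.1 μν.2 p =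
        ∫ ω, W ω * (char (s ω) p.1 * char (t ω) p.2 * S ω p) ∂m := by
    obtain ⟨T, hTc, hT0⟩ := hT p
    rw [tsum_eq_sum (s := T) fun q hq => by rw [hT0 q hq, mul_zero]]
    have hterm (q : Zn n × Zn n) : Integrable (fun ω => W ω *
        (char (s ω) p.1 * char (t ω) p.2 * (a ω q.1 * b ω q.2)) * σf q.1 q.2 p) m := by
      refine (hW.mul_bdd (c := 1) (Measurable.aestronglyMeasurable ?_)
        (Eventually.of_forall fun ω => ?_)).mul_const _
      · have h1 : Measurable fun ω => char (s ω) p.1 :=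
          measurable_char hs measurable_const
        have h2 : Measurable fun ω => char (t ω) p.2 :=
          measurable_char ht measurable_const
        exact (h1.mul h2).mul ((ham _).mul (hbm _))
      · simp only [norm_mul, norm_char, one_mul]
        exact mul_le_one₀ (ha1 _ _) (norm_nonneg _) (hb1 _ _)
    simp_rw [hΦ, ← integral_mul_const]
    rw [← integral_finsetSum _ fun q _ => hterm q]
    congr 1; ext ω
    simp only [hS]
    rw [tsum_eq_sum (s := T) fun q hq => by rw [hT0 q hq, mul_zero], Finset.mul_sum,
      Finset.mul_sum]
    exact Finset.sum_congr rfl fun q _ => by ring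
  simp_rw [hrep]
  exact multNorm_integral_le m hWm hW hs ht hSm hSb fun ω => hM _ _ (ha ω) (hb ω)

end BilinearMultiplier

open BilinearMultiplier

/-- Lemma: from unconditional bounds to `Φ`-sums. -/
theorem statement4 (n : ℕ) (K : ℝ) (hK : 0 < K) (Φ : Rn n × Rn n → ℂ) (hΦ : IsCcInfty Φ) :
    ∃ c : ℝ≥0∞, c < ∞ ∧
      ∀ (σf : Zn n → Zn n → Rn n × Rn n → ℂ) (M : ℝ≥0),
        (∀ μ ν, Measurable (σf μ ν)) →
        (∃ C : ℝ, ∀ μ ν p, ‖σf μ ν p‖ ≤ C) →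
        (∀ μ ν, ∀ p : Rn n × Rn n, σf μ ν p ≠ 0 →
            p.1 - coeZ μ ∈ cube n K ∧ p.2 - coeZ ν ∈ cube n K) →
        (∀ α α' : Zn n → ℂ, (∀ μ, α μ = 0 ∨ α μ = 1) → (∀ ν, α' ν = 0 ∨ α' ν = 1) →
            multNorm ⊤ (fun p : Rn n × Rn n =>
              ∑' μν : Zn n × Zn n, α μν.1 * α' μν.2 * σf μν.1 μν.2 p) ≤ (M : ℝ≥0∞)) →
        multNorm ⊤ (fun p : Rn n × Rn n =>
            ∑' μν : Zn n × Zn n, Φ (p.1 - coeZ μν.1, p.2 - coeZ μν.2) * σf μν.1 μν.2 p)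
          ≤ c * M := by

  obtain ⟨κ, hκ, hsec⟩ := exists_sector_average
  obtain ⟨w, hw⟩ := exists_fourier_representation hΦ
  let D : Measure ℂ := volume.restrict (Metric.ball (0 : ℂ) 1)
  let W : EuclideanSpace ℝ (Fin n ⊕ Fin n) × (ℂ × ℂ) → ℂ :=
    fun ω => w ω.1 * ((κ⁻¹ * ω.2.1) * (κ⁻¹ * ω.2.2))
  let s : EuclideanSpace ℝ (Fin n ⊕ Fin n) × (ℂ × ℂ) → Rn n := fun ω i => ω.1 (Sum.inl i)
  let t : EuclideanSpace ℝ (Fin n ⊕ Fin n) × (ℂ × ℂ) → Rn n := fun ω i => ω.1 (Sum.inr i)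
  let sector : ℂ → ℂ → ℂ := fun c z => if 0 < ((starRingEnd ℂ) c * z).re then 1 else 0
  have hs : Measurable s := by fun_prop
  have ht : Measurable t := by fun_prop
  have hsector (X : Type) [MeasurableSpace X] (u v : X → ℂ) (hu : Measurable u)
      (hv : Measurable v) : Measurable fun x => sector (u x) (v x) := by
    refine Measurable.ite (measurableSet_lt measurable_const ?_) measurable_const measurable_const
    exact Complex.measurable_re.comp ((Complex.continuous_conj.measurable.comp hu).mul hv)
  have hsector01 (c z : ℂ) : sector c z = 0 ∨ sector c z = 1 := by
    simp only [sector]; split_ifs <;> simp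
  have hWm : Measurable W := by
    have := w.continuous.measurable
    fun_prop
  have hDi : Integrable (fun c : ℂ => κ⁻¹ * c) D :=
    (continuous_id.continuousOn.integrableOn_compact (isCompact_closedBall (0 : ℂ) 1) |>.mono_set
      Metric.ball_subset_closedBall).const_mul _
  have hW : Integrable W (volume.prod (D.prod D)) := w.integrable.mul_prod (hDi.mul_prod hDi)
  refine ⟨∫⁻ ω, ‖W ω‖ₑ ∂(volume.prod (D.prod D)), hW.2, fun σf M hσ hC hsupp hM => ?_⟩
  obtain ⟨C, hC⟩ := hC
  refine multNorm_tsum_le_of_representation _ hWm hW hs ht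
    (a := fun ω μ => sector ω.2.1 (char (s ω) (-coeZ μ)))
    (b := fun ω ν => sector ω.2.2 (char (t ω) (-coeZ ν)))
    (fun μ => hsector _ _ _ (by fun_prop)
      (measurable_char hs measurable_const))
    (fun ν => hsector _ _ _ (by fun_prop)
      (measurable_char ht measurable_const))
    (fun _ _ => hsector01 _ _) (fun _ _ => hsector01 _ _) (fun μ ν p => ?_) hσ hC hsupp hM
  have havg (z : ℂ) (hz : ‖z‖ = 1) : ∫ c, (κ⁻¹ * c) * sector c z ∂D = z := by
    simp_rw [mul_assoc, integral_const_mul]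
    rw [hsec z hz, inv_mul_cancel_left₀ hκ]
  rw [hw]
  have hint : Integrable (fun ω : EuclideanSpace ℝ (Fin n ⊕ Fin n) × (ℂ × ℂ) => W ω *
      (char (s ω) p.1 * char (t ω) p.2 *
        (sector ω.2.1 (char (s ω) (-coeZ μ)) *
          sector ω.2.2 (char (t ω) (-coeZ ν))))) (volume.prod (D.prod D)) := by
    have hs1 (c z : ℂ) : ‖sector c z‖ ≤ 1 := by
      rcases hsector01 c z with h | h <;> simp [h]
    refine hW.mul_bdd (c := 1) (Measurable.aestronglyMeasurable ?_)
      (Filter.Eventually.of_forall fun ω => ?_)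
    · exact ((measurable_char hs measurable_const).mul
        (measurable_char ht measurable_const)).mul
        ((hsector _ _ _ (by fun_prop) (measurable_char hs measurable_const)).mul
        (hsector _ _ _ (by fun_prop) (measurable_char ht measurable_const)))
    · simp only [norm_mul, norm_char, one_mul]
      exact mul_le_one₀ (hs1 _ _) (norm_nonneg _) (hs1 _ _)
  rw [integral_prod _ hint]
  congr 1; ext v
  rw [sub_eq_add_neg, sub_eq_add_neg, char_add_right,
    char_add_right]
  rw [← havg (char (fun i => v (Sum.inl i)) (-coeZ μ))
      (norm_char _ _),
    ← havg (char (fun i => v (Sum.inr i)) (-coeZ ν))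
      (norm_char _ _),
    mul_mul_mul_comm, ← integral_prod_mul, ← integral_const_mul, ← integral_const_mul]
  congr 1; ext c
  simp only [W, s, t]
  ring
end
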